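/- arXiv:1005.2247 — 2 statements merged into one kernel-verified Lean document; each statement's English description precedes it below -/
import Mathlib

section
/- Let X be a real Banach space, A : X ⇉ X* maximal monotone of type (FPV) with convex domain, and B : X ⇉ X* maximal monotone with dom A ∩ int dom B ≠ ∅ and dom A ∩ cl(dom B) ⊆ dom B. Then A + B is maximal monotone. -/
open Set Filter Pointwise

noncomputable section

variable {X : Type*}

abbrev Dual' (X : Type*) [NormedAddCommGroup X] [NormedSpace ℝ X] := X →L[ℝ] ℝ

section Defs
variable [NormedAddCommGroup X] [NormedSpace ℝ X]

/-- `A` is a monotone operator. -/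
def MonotoneOp (A : X → Set (Dual' X)) : Prop :=
  ∀ x y (x' y' : Dual' X), x' ∈ A x → y' ∈ A y → 0 ≤ (x' - y') (x - y)

/-- `A` is maximal monotone: monotone, and every monotonically related pair is in the graph. -/
def MaxMonotone (A : X → Set (Dual' X)) : Prop :=
  MonotoneOp A ∧
    ∀ x (x' : Dual' X), (∀ y y', y' ∈ A y → 0 ≤ (x' - y') (x - y)) → x' ∈ A x

/-- domain of a set-valued operator -/
def domOp (A : X → Set (Dual' X)) : Set X := {x | (A x).Nonempty}

/-- pointwise Minkowski sum of two set-valued operators -/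
def opSum (A B : X → Set (Dual' X)) : X → Set (Dual' X) := fun x => A x + B x

/-- normal cone operator of a set `C` -/
def normalCone (C : Set X) : X → Set (Dual' X) :=
  fun x => {x' | x ∈ C ∧ ∀ c ∈ C, x' (c - x) ≤ 0}

/-- the Fitzpatrick function of `A` -/
def fitz (A : X → Set (Dual' X)) : X × Dual' X → EReal :=
  fun p => ⨆ q ∈ {q : X × Dual' X | q.2 ∈ A q.1},
    ((q.2 p.1 + p.2 q.1 - q.2 q.1 : ℝ) : EReal)

/-- `A` is maximal monotone of type (FPV) -/
def FPV (A : X → Set (Dual' X)) : Prop :=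
  MaxMonotone A ∧
    ∀ U : Set X, IsOpen U → Convex ℝ U → (U ∩ domOp A).Nonempty →
      ∀ x (x' : Dual' X), x ∈ U →
        (∀ y y', y' ∈ A y → y ∈ U → 0 ≤ (x' - y') (x - y)) → x' ∈ A x

/-- `A` is a linear relation: its graph is a linear subspace of `X × X*` -/
def LinearRel (A : X → Set (Dual' X)) : Prop :=
  (0 : Dual' X) ∈ A 0 ∧
  (∀ x y (x' y' : Dual' X), x' ∈ A x → y' ∈ A y → x' + y' ∈ A (x + y)) ∧
  (∀ (c : ℝ) x (x' : Dual' X), x' ∈ A x → c • x' ∈ A (c • x))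

/-- subdifferential of an extended-real-valued function -/
def subdiff (f : X → EReal) : X → Set (Dual' X) :=
  fun x => {x' | ∀ y, ((x' (y - x) : ℝ) : EReal) + f x ≤ f y}

/-- `f` is proper: never `⊥` and not identically `⊤` -/
def ProperFun (f : X → EReal) : Prop := (∀ x, f x ≠ ⊥) ∧ ∃ x, f x ≠ ⊤

/-- convexity for extended-real-valued functions -/
def EConvexOn (f : X → EReal) : Prop :=
  ∀ x y (t : ℝ), 0 ≤ t → t ≤ 1 →
    f (t • x + (1 - t) • y) ≤ (t : EReal) * f x + ((1 - t : ℝ) : EReal) * f y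

/-- effective domain of an extended-real-valued function -/
def domFun (f : X → EReal) : Set X := {x | f x ≠ ⊤}

end Defs

section SumTheorem

open scoped Topology

variable [NormedAddCommGroup X] [NormedSpace ℝ X]

/-- `EpiFitz T x a r` says that the Fitzpatrick function of `T` at `(x, a)` is at most `r`. -/
def EpiFitz (T : X → Set (Dual' X)) (x : X) (a : Dual' X) (r : ℝ) : Prop :=
  ∀ p (p' : Dual' X), p' ∈ T p → p' (x - p) + a p ≤ r

theorem EpiFitz.of_mem {T : X → Set (Dual' X)} (hT : MonotoneOp T) {x : X} {a : Dual' X}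
    (ha : a ∈ T x) : EpiFitz T x a (a x) := by
  intro p p' hp
  have h := hT x p a p' ha hp
  simp only [map_sub, sub_apply] at h ⊢
  linarith

theorem EpiFitz.combo {T : X → Set (Dual' X)} {x y : X} {a b : Dual' X} {r s t u : ℝ}
    (hx : EpiFitz T x a r) (hy : EpiFitz T y b s) (ht : 0 ≤ t) (hu : 0 ≤ u) (htu : t + u = 1) :
    EpiFitz T (t • x + u • y) (t • a + u • b) (t * r + u * s) := by
  intro p p' hp
  have h1 := mul_le_mul_of_nonneg_left (hx p p' hp) ht
  have h2 := mul_le_mul_of_nonneg_left (hy p p' hp) hu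
  have h3 : p' p = t * p' p + u * p' p := by rw [← add_mul, htu, one_mul]
  simp only [map_sub, map_add, map_smul, smul_eq_mul, add_apply,
    smul_apply] at h1 h2 ⊢
  linarith

/-- The Fitzpatrick function of a maximal monotone operator dominates the duality pairing. -/
theorem EpiFitz.pairing_le {T : X → Set (Dual' X)} (hT : MaxMonotone T) {x : X} {a : Dual' X}
    {r : ℝ} (h : EpiFitz T x a r) : a x ≤ r := by
  by_contra! hlt
  have key : ∀ p (p' : Dual' X), p' ∈ T p → 0 < (a - p') (x - p) := by
    intro p p' hp
    have h1 := h p p' hp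
    simp only [map_sub, sub_apply] at h1 ⊢
    linarith
  have := key x a (hT.2 x a fun p p' hp => (key p p' hp).le)
  simp at this

/-- A convex set in `X × ℝ` that is closed upwards, bounded below over `0` and contains a ball at
some height lies above the graph of a continuous linear functional. -/
theorem exists_dual_le_of_convex {E : Set (X × ℝ)} (hE : Convex ℝ E)
    (hup : ∀ v r r', (v, r) ∈ E → r ≤ r' → (v, r') ∈ E) {ε M : ℝ} (hε : 0 < ε)
    (hball : ∀ v, ‖v‖ < ε → (v, M) ∈ E) (h0 : ∀ r, ((0 : X), r) ∈ E → 0 ≤ r) :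
    ∃ p : Dual' X, ∀ v r, (v, r) ∈ E → p v ≤ r := by
  have hsub : Metric.ball (0 : X) ε ×ˢ Ioi M ⊆ interior E := by
    apply interior_maximal
    · rintro ⟨v, r⟩ ⟨hv, hr⟩
      exact hup v M r (hball v (by simpa using hv)) (le_of_lt hr)
    · exact Metric.isOpen_ball.prod isOpen_Ioi
  have hmem : ∀ r, M < r → ((0 : X), r) ∈ interior E := fun r hr =>
    hsub ⟨by simpa using hε, hr⟩
  have hnot : ((0 : X), (0 : ℝ)) ∉ interior E := by
    intro h
    have hc : Tendsto (fun s : ℝ => ((0 : X), s)) (𝓝 0) (𝓝 ((0 : X), (0 : ℝ))) :=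
      (Continuous.prodMk_right (0 : X)).tendsto 0
    have h1 : ∀ᶠ s : ℝ in 𝓝 0, ((0 : X), s) ∈ E :=
      hc.eventually (mem_interior_iff_mem_nhds.1 h)
    obtain ⟨s, hs, hs'⟩ := (h1.filter_mono (nhdsWithin_le_nhds (s := Iio 0))).and
      self_mem_nhdsWithin |>.exists
    exact absurd (h0 s hs) (not_le.2 hs')
  obtain ⟨f, hf⟩ := geometric_hahn_banach_open_point hE.interior isOpen_interior hnot
  have hf0 : f ((0 : X), (0 : ℝ)) = 0 := map_zero f
  rw [hf0] at hf
  have hle : ∀ e ∈ E, f e ≤ 0 := by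
    intro e he
    have h1 : e ∈ closure (interior E) := by
      rw [hE.closure_interior_eq_closure_of_nonempty_interior ⟨_, hmem (M + 1) (by linarith)⟩]
      exact subset_closure he
    have h2 : closure (interior E) ⊆ {e | f e ≤ 0} :=
      closure_minimal (fun e he => (hf e he).le) (isClosed_le f.continuous continuous_const)
    exact h2 h1
  have hdec : ∀ v r, f (v, r) = f (v, 0) + r * f (0, 1) := by
    intro v r
    rw [← smul_eq_mul, ← map_smul, ← map_add]
    simp
  have hc : f (0, 1) < 0 := by
    have h1 := hf _ (hmem (|M| + 1) (by linarith [le_abs_self M]))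
    rw [hdec, hf0, zero_add] at h1
    by_contra! h2
    linarith [mul_nonneg (by positivity : 0 ≤ |M| + 1) h2]
  refine ⟨(-f (0, 1))⁻¹ • f.comp (ContinuousLinearMap.inl ℝ X ℝ), fun v r hvr => ?_⟩
  have h1 := hle _ hvr
  rw [hdec] at h1
  simp only [smul_apply, ContinuousLinearMap.comp_apply,
    ContinuousLinearMap.inl_apply, smul_eq_mul]
  rw [inv_mul_le_iff₀ (by linarith)]
  linarith

/-- A monotone operator on a Banach space is locally bounded at interior points of its domain. -/
theorem MonotoneOp.locallyBounded [CompleteSpace X] {T : X → Set (Dual' X)} (hT : MonotoneOp T)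
    {x₀ : X} (hx₀ : x₀ ∈ interior (domOp T)) :
    ∃ δ > 0, ∃ M : ℝ, 0 ≤ M ∧ Metric.ball x₀ δ ⊆ interior (domOp T) ∧
      ∀ y ∈ Metric.ball x₀ δ, ∀ b ∈ T y, ‖b‖ ≤ M := by
  obtain ⟨δ, hδ, hball⟩ := Metric.isOpen_iff.1 isOpen_interior x₀ hx₀
  let S : ℝ → Set X := fun n => {v | ∀ y b, b ∈ T y → ‖y - x₀‖ ≤ 1 → b (x₀ + v - y) ≤ n}
  have hSmono : ∀ {m n : ℝ}, m ≤ n → S m ⊆ S n := fun hmn v hv y b hb hy =>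
    (hv y b hb hy).trans hmn
  have hSclosed : ∀ n, IsClosed (S n) := by
    intro n
    simp only [S, ofPred_forall]
    refine isClosed_iInter fun y => isClosed_iInter fun b => isClosed_iInter fun _ =>
      isClosed_iInter fun _ => isClosed_le (by fun_prop) continuous_const
  have hSconv : ∀ n, Convex ℝ (S n) := by
    intro n v hv w hw s t hs ht hst y b hb hy
    have h1 := mul_le_mul_of_nonneg_left (hv y b hb hy) hs
    have h2 := mul_le_mul_of_nonneg_left (hw y b hb hy) ht
    have h3 : b x₀ = s * b x₀ + t * b x₀ := by rw [← add_mul, hst, one_mul]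
    have h4 : b y = s * b y + t * b y := by rw [← add_mul, hst, one_mul]
    have h5 : n = s * n + t * n := by rw [← add_mul, hst, one_mul]
    simp only [map_sub, map_add, map_smul, smul_eq_mul] at h1 h2 ⊢
    linarith
  have hSball : ∀ v : X, ‖v‖ < δ → ∃ n, v ∈ S n := by
    intro v hv
    obtain ⟨c, hc⟩ := interior_subset (hball (show x₀ + v ∈ Metric.ball x₀ δ by simpa using hv))
    refine ⟨‖c‖ * (‖v‖ + 1), fun y b hb hy => ?_⟩
    have h1 := hT (x₀ + v) y c b hc hb
    have h2 : c (x₀ + v - y) ≤ ‖c‖ * (‖v‖ + 1) := by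
      refine (le_abs_self _).trans ((c.le_opNorm _).trans ?_)
      gcongr
      calc ‖x₀ + v - y‖ = ‖v - (y - x₀)‖ := by congr 1; abel
        _ ≤ ‖v‖ + ‖y - x₀‖ := norm_sub_le _ _
        _ ≤ ‖v‖ + 1 := by gcongr
    rw [sub_apply] at h1
    linarith
  obtain ⟨⟨k, n⟩, v₁, hv₁⟩ : ∃ kn : ℕ × ℕ,
      (interior ((fun v : X => ((kn.1 : ℝ) + 1)⁻¹ • v) ⁻¹' S kn.2)).Nonempty := by
    apply nonempty_interior_of_iUnion_of_closed
    · exact fun kn => (hSclosed _).preimage (continuous_const_smul _)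
    · refine eq_univ_of_forall fun v => mem_iUnion.2 ?_
      obtain ⟨k, hk⟩ := exists_nat_gt (‖v‖ / δ)
      obtain ⟨r, hr⟩ := hSball (((k : ℝ) + 1)⁻¹ • v) (by
        rw [norm_smul, norm_inv, Real.norm_of_nonneg (by positivity), inv_mul_lt_iff₀ (by positivity)]
        rw [div_lt_iff₀ hδ] at hk
        linarith)
      obtain ⟨n, hn⟩ := exists_nat_ge r
      exact ⟨(k, n), hSmono hn hr⟩
  obtain ⟨ε, hε, hεball⟩ := Metric.isOpen_iff.1 isOpen_interior v₁ hv₁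
  have hk : (0 : ℝ) < (k : ℝ) + 1 := by positivity
  set q : ℝ := ((k : ℝ) + 1)⁻¹ with hq
  have hq0 : 0 < q := inv_pos.2 hk
  obtain ⟨c, hc, hcv⟩ : ∃ c : ℝ, 0 < c ∧ c * ‖q • v₁‖ < δ := by
    refine ⟨δ / (‖q • v₁‖ + 1), by positivity, ?_⟩
    rw [div_mul_eq_mul_div, div_lt_iff₀ (by positivity)]
    nlinarith [norm_nonneg (q • v₁)]
  obtain ⟨m, hm⟩ := hSball (-(c • q • v₁)) (by
    rwa [norm_neg, norm_smul, Real.norm_of_nonneg hc.le])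
  obtain ⟨N, hN0, hN⟩ : ∃ N : ℝ, 0 ≤ N ∧ ∀ v : X, ‖v‖ < c / (1 + c) * q * ε → v ∈ S N := by
    refine ⟨max (max n m) 0, le_max_right _ _, fun v hv => ?_⟩
    have h1 : q • (v₁ + ((1 + c) / c * q⁻¹) • v) ∈ S (max (max n m) 0) := by
      refine hSmono ((le_max_left _ _).trans (le_max_left _ _)) ?_
      change v₁ + ((1 + c) / c * q⁻¹) • v ∈ (fun v : X => q • v) ⁻¹' S n
      refine interior_subset (hεball ?_)
      rw [mem_ball_iff_norm, add_sub_cancel_left, norm_smul, Real.norm_of_nonneg (by positivity)]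
      calc (1 + c) / c * q⁻¹ * ‖v‖ < (1 + c) / c * q⁻¹ * (c / (1 + c) * q * ε) := by gcongr
        _ = ε := by field_simp
    have h2 := hSmono ((le_max_right (n : ℝ) m).trans (le_max_left _ 0)) hm
    have h3 := hSconv _ h1 h2 (show 0 ≤ c / (1 + c) by positivity)
      (show 0 ≤ 1 / (1 + c) by positivity) (by field_simp; ring)
    convert h3 using 1
    simp only [smul_add, smul_neg, smul_smul]
    have e1 : c / (1 + c) * (q * ((1 + c) / c * q⁻¹)) = 1 := by field_simp
    have e2 : 1 / (1 + c) * (c * q) = c / (1 + c) * q := by ring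
    rw [e1, e2]
    simp
  set s : ℝ := c / (1 + c) * q * ε with hs
  have hs0 : 0 < s := by positivity
  set η : ℝ := min (min δ 1) (s / 4) with hη
  have hη0 : 0 < η := by positivity
  refine ⟨η, hη0, 4 * N / s, by positivity, fun y hy => hball
    (Metric.ball_subset_ball ((min_le_left _ _).trans (min_le_left _ _)) hy), fun y hy b hb => ?_⟩
  have hy1 : ‖y - x₀‖ < η := mem_ball_iff_norm.1 hy
  have hy2 : ‖y - x₀‖ ≤ 1 := hy1.le.trans ((min_le_left _ _).trans (min_le_right _ _))
  have hy3 : ‖y - x₀‖ ≤ s / 4 := hy1.le.trans (min_le_right _ _)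
  have hbv : ∀ v : X, ‖v‖ < s → b v ≤ N + ‖b‖ * (s / 4) := by
    intro v hv
    have h1 := hN v hv y b hb hy2
    have h2 : b (y - x₀) ≤ ‖b‖ * (s / 4) :=
      (le_abs_self _).trans ((b.le_opNorm _).trans (by gcongr))
    simp only [map_sub, map_add] at h1 h2
    linarith
  have hbn : ‖b‖ ≤ (N + ‖b‖ * (s / 4)) / (s / 2) := by
    refine b.opNorm_le_bound (by positivity) fun v => ?_
    rcases eq_or_ne v 0 with rfl | hv
    · simp
    have hv0 : 0 < ‖v‖ := norm_pos_iff.2 hv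
    have hnorm : ‖(s / 2 / ‖v‖) • v‖ < s := by
      rw [norm_smul, Real.norm_of_nonneg (by positivity), div_mul_cancel₀ _ hv0.ne']
      linarith
    have h1 := hbv _ hnorm
    have h2 := hbv (-((s / 2 / ‖v‖) • v)) (by rwa [norm_neg])
    rw [map_neg] at h2
    rw [map_smul, smul_eq_mul] at h1 h2
    have h3 : s / 2 / ‖v‖ * |b v| ≤ N + ‖b‖ * (s / 4) := by
      rcases abs_cases (b v) with ⟨h, _⟩ | ⟨h, _⟩ <;> rw [h] <;> linarith
    rw [Real.norm_eq_abs, div_mul_eq_mul_div, le_div_iff₀ (by positivity)]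
    rw [div_mul_eq_mul_div, div_le_iff₀ hv0] at h3
    linarith
  rw [le_div_iff₀ (by positivity)] at hbn
  rw [le_div_iff₀ hs0]
  linarith

/-- Rockafellar: segments from an interior point of the domain of a maximal monotone operator to
another point of the domain stay inside the interior, except possibly for the endpoint. -/
theorem MaxMonotone.combo_mem_domOp [CompleteSpace X] {T : X → Set (Dual' X)} (hT : MaxMonotone T)
    {x₀ z : X} (hx₀ : x₀ ∈ interior (domOp T)) (hz : z ∈ domOp T) {t u : ℝ} (ht : 0 < t)
    (hu : 0 ≤ u) (htu : t + u = 1) : t • x₀ + u • z ∈ domOp T := by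
  obtain ⟨δ, hδ, M, hM, hsub, hbd⟩ := hT.1.locallyBounded hx₀
  obtain ⟨c, hc⟩ := hz
  set w := t • x₀ + u • z with hw
  let E : Set (X × ℝ) := {e | ∃ b r, EpiFitz T (w + e.1) b r ∧ r - b w ≤ e.2}
  have hE : Convex ℝ E := by
    rintro ⟨v₁, s₁⟩ ⟨b₁, r₁, h₁, hr₁⟩ ⟨v₂, s₂⟩ ⟨b₂, r₂, h₂, hr₂⟩ p q hp hq hpq
    refine ⟨p • b₁ + q • b₂, p * r₁ + q * r₂, ?_, ?_⟩
    · have h3 := h₁.combo h₂ hp hq hpq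
      convert h3 using 1
      simp only [Prod.smul_mk, Prod.mk_add_mk, smul_add]
      rw [add_add_add_comm (p • w), ← add_smul p q, hpq, one_smul]
    · have h3 := mul_le_mul_of_nonneg_left hr₁ hp
      have h4 := mul_le_mul_of_nonneg_left hr₂ hq
      simp only [Prod.smul_mk, Prod.mk_add_mk, smul_eq_mul, add_apply, smul_apply] at h3 h4 ⊢
      linarith
  obtain ⟨p, hp⟩ := exists_dual_le_of_convex hE (ε := t * δ)
    (M := t * (M * (‖x₀‖ + δ)) + u * c z + ((t * M + u * ‖c‖) * ‖w‖))
    (fun v r r' ⟨b, s, h, hs⟩ hr => ⟨b, s, h, hs.trans hr⟩) (by positivity)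
    (fun v hv => by
      have hx : x₀ + t⁻¹ • v ∈ Metric.ball x₀ δ := by
        rw [mem_ball_iff_norm, add_sub_cancel_left, norm_smul, norm_inv,
          Real.norm_of_nonneg ht.le, inv_mul_lt_iff₀ ht]
        exact hv
      obtain ⟨b, hb⟩ := interior_subset (hsub hx)
      have hbM := hbd _ hx b hb
      refine ⟨t • b + u • c, t * b (x₀ + t⁻¹ • v) + u * c z, ?_, ?_⟩
      · have h := (EpiFitz.of_mem hT.1 hb).combo (EpiFitz.of_mem hT.1 hc) ht.le hu htu
        convert h using 1
        rw [smul_add, smul_smul, mul_inv_cancel₀ ht.ne', one_smul, hw]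
        abel
      · have h1 : b (x₀ + t⁻¹ • v) ≤ M * (‖x₀‖ + δ) := by
          refine (le_abs_self _).trans ((b.le_opNorm _).trans ?_)
          gcongr
          rw [mem_ball_iff_norm] at hx
          calc ‖x₀ + t⁻¹ • v‖ = ‖x₀ + (x₀ + t⁻¹ • v - x₀)‖ := by congr 1; abel
            _ ≤ ‖x₀‖ + ‖x₀ + t⁻¹ • v - x₀‖ := norm_add_le _ _
            _ ≤ ‖x₀‖ + δ := by gcongr
        have h2 : -(t • b + u • c) w ≤ (t * M + u * ‖c‖) * ‖w‖ := by
          refine (neg_le_abs _).trans (((t • b + u • c).le_opNorm _).trans ?_)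
          gcongr
          calc ‖t • b + u • c‖ ≤ ‖t • b‖ + ‖u • c‖ := norm_add_le _ _
            _ = t * ‖b‖ + u * ‖c‖ := by
              rw [norm_smul, norm_smul, Real.norm_of_nonneg ht.le, Real.norm_of_nonneg hu]
            _ ≤ t * M + u * ‖c‖ := by gcongr
        have h3 := mul_le_mul_of_nonneg_left h1 ht.le
        dsimp only
        linarith)
    (fun r ⟨b, s, h, hs⟩ => by
      have h1 := h.pairing_le hT
      simp only [add_zero] at h1 hs
      linarith)
  refine ⟨p, hT.2 w p fun y y' hy => ?_⟩
  have h1 := hp (y - w) (y' y - y' w) ⟨y', y' y, by simpa using EpiFitz.of_mem hT.1 hy, le_rfl⟩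
  simp only [map_sub, sub_apply] at h1 ⊢
  linarith

theorem MaxMonotone.combo_mem_interior [CompleteSpace X] {T : X → Set (Dual' X)}
    (hT : MaxMonotone T) {x₀ z : X} (hx₀ : x₀ ∈ interior (domOp T)) (hz : z ∈ domOp T) {t u : ℝ}
    (ht : 0 < t) (hu : 0 ≤ u) (htu : t + u = 1) : t • x₀ + u • z ∈ interior (domOp T) := by
  have hopen : IsOpen ((fun w : X => t⁻¹ • (w - u • z)) ⁻¹' interior (domOp T)) :=
    isOpen_interior.preimage (by fun_prop)
  refine interior_maximal (fun w hw => ?_) hopen ?_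
  · have h := hT.combo_mem_domOp hw hz ht hu htu
    simpa [smul_smul, mul_inv_cancel₀ ht.ne'] using h
  · simpa [smul_smul, inv_mul_cancel₀ ht.ne'] using hx₀

theorem MaxMonotone.convex_interior_domOp [CompleteSpace X] {T : X → Set (Dual' X)}
    (hT : MaxMonotone T) : Convex ℝ (interior (domOp T)) := by
  intro x hx y hy s t hs ht hst
  rcases hs.eq_or_lt with rfl | hs
  · obtain rfl : t = 1 := by linarith
    simpa using hy
  · exact hT.combo_mem_interior hx (interior_subset hy) hs ht hst

theorem MaxMonotone.closure_interior_domOp [CompleteSpace X] {T : X → Set (Dual' X)}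
    (hT : MaxMonotone T) (hne : (interior (domOp T)).Nonempty) :
    closure (interior (domOp T)) = closure (domOp T) := by
  obtain ⟨x₀, hx₀⟩ := hne
  refine (closure_mono interior_subset).antisymm (closure_minimal (fun z hz => ?_) isClosed_closure)
  have hlim : Tendsto (fun t : ℝ => t • x₀ + (1 - t) • z) (𝓝[>] 0) (𝓝 z) := by
    have h : Continuous fun t : ℝ => t • x₀ + (1 - t) • z := by fun_prop
    have h2 := (h.tendsto 0).mono_left (nhdsWithin_le_nhds (s := Ioi 0))
    simpa using h2
  refine mem_closure_of_tendsto hlim ?_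
  filter_upwards [self_mem_nhdsWithin, nhdsWithin_le_nhds (Iio_mem_nhds one_pos)] with t ht ht1
  exact hT.combo_mem_interior hx₀ hz ht (sub_nonneg.2 (le_of_lt ht1)) (by ring)

/-- Points near the segment `[x₀, z]` but away from `z`: the direction towards `z` is a positive
multiple of a direction away from a point near `x₀`, and it is uniformly positive on a functional. -/
theorem exists_thickening_segment (x₀ z : X) {δ ρ : ℝ} (hδ : 0 < δ) (hρ : 0 < ρ) :
    ∃ η > 0, ∃ w : Dual' X, ∀ y ∈ Metric.thickening η (segment ℝ x₀ z), ρ ≤ ‖z - y‖ →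
      ‖z - y‖ ≤ 2 * w (z - y) ∧
      (y ∈ Metric.ball x₀ δ ∨ ∃ κ : ℝ, 0 < κ ∧ ∃ x ∈ Metric.ball x₀ δ, z - y = κ • (y - x)) := by
  obtain ⟨w, hw, hwz⟩ := exists_dual_vector'' ℝ (z - x₀)
  set L := ‖z - x₀‖ with hL
  have hL0 : 0 ≤ L := norm_nonneg _
  refine ⟨min (ρ / 6) (δ * ρ / (2 * (L + 1))), by positivity, w, fun y hy hzy => ?_⟩
  obtain ⟨p, hp, hyp⟩ := Metric.mem_thickening_iff.1 hy
  rw [segment_eq_image'] at hp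
  obtain ⟨θ, ⟨hθ0, hθ1⟩, rfl⟩ := hp
  dsimp only at hyp
  obtain ⟨e, rfl⟩ : ∃ e, y = x₀ + θ • (z - x₀) + e := ⟨y - (x₀ + θ • (z - x₀)), by abel⟩
  rw [dist_eq_norm, add_sub_cancel_left, lt_min_iff] at hyp
  obtain ⟨he1, he2⟩ := hyp
  have hdec : z - (x₀ + θ • (z - x₀) + e) = (1 - θ) • (z - x₀) - e := by
    rw [sub_smul, one_smul]; abel
  have hnorm : ‖z - (x₀ + θ • (z - x₀) + e)‖ ≤ (1 - θ) * L + ‖e‖ := by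
    rw [hdec]
    refine (norm_sub_le _ _).trans_eq ?_
    rw [norm_smul, Real.norm_of_nonneg (by linarith)]
  have hwe : w e ≤ ‖e‖ :=
    (le_abs_self _).trans ((w.le_opNorm e).trans (mul_le_of_le_one_left (norm_nonneg _) hw))
  have hwdec : w (z - (x₀ + θ • (z - x₀) + e)) = (1 - θ) * L - w e := by
    rw [hdec, map_sub, map_smul, hwz]
    rfl
  have hθ : 0 < 1 - θ := by
    by_contra! h
    nlinarith
  have heδ : ‖e‖ < (1 - θ) * δ := by
    refine he2.trans_le ?_
    rw [div_le_iff₀ (by positivity)]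
    nlinarith
  refine ⟨by rw [hwdec]; linarith, ?_⟩
  rcases hθ0.eq_or_lt with rfl | hθ0
  · left
    simpa [mem_ball_iff_norm] using heδ
  · right
    refine ⟨(1 - θ) / θ, by positivity, x₀ + (1 - θ)⁻¹ • e, ?_, ?_⟩
    · rwa [mem_ball_iff_norm, add_sub_cancel_left, norm_smul, norm_inv,
        Real.norm_of_nonneg hθ.le, inv_mul_lt_iff₀ hθ]
    · rw [hdec]
      have : x₀ + θ • (z - x₀) + e - (x₀ + (1 - θ)⁻¹ • e) =
          θ • (z - x₀) + (1 - (1 - θ)⁻¹) • e := by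
        rw [sub_smul, one_smul]; abel
      rw [this, smul_add, smul_smul, smul_smul, div_mul_cancel₀ _ hθ0.ne', sub_eq_add_neg]
      congr 1
      rw [← neg_one_smul ℝ e]
      congr 1
      field_simp
      ring

theorem FPV.exists_neg {A : X → Set (Dual' X)} (hA : FPV A) {U : Set X} (hU : IsOpen U)
    (hUc : Convex ℝ U) (hne : (U ∩ domOp A).Nonempty) {z : X} (hz : z ∈ U) (hzA : z ∉ domOp A)
    (z' : Dual' X) : ∃ y ∈ U, ∃ a ∈ A y, (z' - a) (z - y) < 0 := by
  by_contra! h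
  exact hzA ⟨z', hA.2 U hU hUc hne z z' hz fun y y' hy hyU => h y hyU y' hy⟩

/-- If `dom A` stays away from `z` inside a convex open set joining `z` to `x₀`, and lies in `dom B`
there, then no pair `(z, z')` is monotonically related to `A + B`. -/
theorem FPV.exists_sum_neg_of_far [CompleteSpace X] {A B : X → Set (Dual' X)} (hA : FPV A)
    (hB : MonotoneOp B) {x₀ z : X} (hx₀A : x₀ ∈ domOp A) (hx₀B : x₀ ∈ interior (domOp B))
    {U : Set X} (hU : IsOpen U) (hUc : Convex ℝ U) (hx₀U : x₀ ∈ U) (hzU : z ∈ U) {ρ : ℝ}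
    (hρ : 0 < ρ) (h : ∀ y ∈ U, y ∈ domOp A → y ∈ domOp B ∧ ρ ≤ ‖z - y‖) (z' : Dual' X) :
    ∃ y, ∃ a ∈ A y, ∃ b ∈ B y, (z' - (a + b)) (z - y) < 0 := by
  obtain ⟨δ, hδ, M, hM, hsub, hbd⟩ := hB.locallyBounded hx₀B
  obtain ⟨η, hη, w, hw⟩ := exists_thickening_segment x₀ z hδ hρ
  have hseg := Metric.self_subset_thickening hη (segment ℝ x₀ z)
  have hzA : z ∉ domOp A := fun hz => by
    have := (h z hzU hz).2
    simp only [sub_self, norm_zero] at this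
    linarith
  obtain ⟨y, ⟨hyU, hyη⟩, a, ha, hneg⟩ := hA.exists_neg (hU.inter Metric.isOpen_thickening)
    (hUc.inter ((convex_segment x₀ z).thickening η))
    ⟨x₀, ⟨hx₀U, hseg (left_mem_segment ℝ x₀ z)⟩, hx₀A⟩
    ⟨hzU, hseg (right_mem_segment ℝ x₀ z)⟩ hzA (z' + (2 * M) • w)
  obtain ⟨⟨b, hb⟩, hρy⟩ := h y hyU ⟨a, ha⟩
  obtain ⟨hwy, hy⟩ := hw y hyη hρy
  refine ⟨y, a, ha, b, hb, ?_⟩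
  have hlow : -(M * ‖z - y‖) ≤ b (z - y) := by
    rcases hy with hy | ⟨κ, hκ, x, hx, hzy⟩
    · refine neg_le_of_abs_le ((b.le_opNorm _).trans ?_)
      gcongr
      exact hbd y hy b hb
    · obtain ⟨c, hc⟩ := interior_subset (hsub hx)
      have h1 := hB y x b c hb hc
      have h2 : -(M * ‖y - x‖) ≤ c (y - x) := by
        refine neg_le_of_abs_le ((c.le_opNorm _).trans ?_)
        gcongr
        exact hbd x hx c hc
      rw [sub_apply] at h1
      rw [hzy, norm_smul, Real.norm_of_nonneg hκ.le, map_smul, smul_eq_mul]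
      have h3 := mul_le_mul_of_nonneg_left (show -(M * ‖y - x‖) ≤ b (y - x) by linarith) hκ.le
      linarith
  have hMw := mul_le_mul_of_nonneg_left hwy hM
  simp only [sub_apply, add_apply, smul_apply, smul_eq_mul] at hneg ⊢
  linarith

/-- Adding a functional supporting the domain preserves membership in a maximal monotone
operator. -/
theorem MaxMonotone.add_smul_mem {T : X → Set (Dual' X)} (hT : MaxMonotone T) {y : X}
    {b n : Dual' X} (hb : b ∈ T y) (hn : ∀ x ∈ domOp T, n x ≤ n y) {K : ℝ} (hK : 0 ≤ K) :
    b + K • n ∈ T y := by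
  refine hT.2 y _ fun x x' hx => ?_
  have h1 := hT.1 y x b x' hb hx
  have h2 := mul_nonneg hK (sub_nonneg.2 (hn x ⟨x', hx⟩))
  simp only [sub_apply, add_apply, smul_apply, smul_eq_mul, map_sub] at h1 ⊢
  linarith

/-- If the Fitzpatrick function of `A + B` dominates the duality pairing and the domain of `A` meets
the interior of the domain of `B`, then `A + B` is maximal monotone. -/
theorem MaxMonotone.opSum_of_forall_exists_lt [CompleteSpace X] {A B : X → Set (Dual' X)}
    (hA : MaxMonotone A) (hB : MaxMonotone B) (hint : (domOp A ∩ interior (domOp B)).Nonempty)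
    (h : ∀ z (z' : Dual' X), ∀ ε > 0, ∃ y, ∃ a ∈ A y, ∃ b ∈ B y, (z' - (a + b)) (z - y) < ε) :
    MaxMonotone (opSum A B) := by
  constructor
  · rintro x y _ _ ⟨a, ha, b, hb, rfl⟩ ⟨c, hc, d, hd, rfl⟩
    have h1 := hA.1 x y a c ha hc
    have h2 := hB.1 x y b d hb hd
    simp only [sub_apply, add_apply] at h1 h2 ⊢
    linarith
  intro z z' hz
  obtain ⟨x₀, ⟨a₀, ha₀⟩, hx₀⟩ := hint
  obtain ⟨δ, hδ, M, hM, hsub, hbd⟩ := hB.1.locallyBounded hx₀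
  have hfitz : ∀ x (a b : Dual' X) r s, EpiFitz A x a r → EpiFitz B x b s →
      0 ≤ r + s - (a + b) z - z' (x - z) := by
    intro x a b r s hr hs
    by_contra! hneg
    set g := r + s - (a + b) z - z' (x - z) with hg
    set D := (a + b - z') (x - z) with hD
    obtain ⟨t, ht0, ht1, ht⟩ : ∃ t : ℝ, 0 < t ∧ t ≤ 1 ∧ g < t * D := by
      refine ⟨min 1 (-g / (2 * (|D| + 1))), ?_, min_le_left _ _, ?_⟩
      · have : 0 < -g := by linarith
        positivity
      · have h1 : min 1 (-g / (2 * (|D| + 1))) * |D| ≤ -g / 2 := by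
          calc min 1 (-g / (2 * (|D| + 1))) * |D| ≤ -g / (2 * (|D| + 1)) * (|D| + 1) := by
                have : 0 < -g := by linarith
                gcongr
                · exact min_le_right _ _
                · linarith
            _ = -g / 2 := by field_simp
        have h2 : 0 < min 1 (-g / (2 * (|D| + 1))) := by
          have : 0 < -g := by linarith
          positivity
        have h3 := mul_le_mul_of_nonneg_left (neg_abs_le D) h2.le
        linarith
    obtain ⟨y, c, hc, d, hd, hlt⟩ := h (z + t • (x - z)) (z' + t • (a + b - z'))
      (t * (t * D - g)) (by nlinarith)
    have h1 := hr y c hc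
    have h2 := hs y d hd
    have h3 := hz y (c + d) ⟨c, hc, d, hd, rfl⟩
    have h4 : t * (c (x - y) + a y + (d (x - y) + b y)) ≤ t * (r + s) :=
      mul_le_mul_of_nonneg_left (by linarith) ht0.le
    have h5 := mul_nonneg (sub_nonneg.2 ht1) h3
    simp only [hg, hD, sub_apply, add_apply, smul_apply, smul_eq_mul, map_sub, map_add,
      map_smul] at h4 h5 hlt
    nlinarith
  let E : Set (X × ℝ) := {e | ∃ x a b r s, EpiFitz A x a r ∧ EpiFitz B (x + e.1) b s ∧
    r + s - (a + b) z - z' (x - z) ≤ e.2}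
  have hE : Convex ℝ E := by
    rintro ⟨v₁, l₁⟩ ⟨x₁, a₁, b₁, r₁, s₁, hr₁, hs₁, h₁⟩ ⟨v₂, l₂⟩ ⟨x₂, a₂, b₂, r₂, s₂, hr₂, hs₂, h₂⟩
      p q hp hq hpq
    refine ⟨p • x₁ + q • x₂, p • a₁ + q • a₂, p • b₁ + q • b₂, p * r₁ + q * r₂, p * s₁ + q * s₂,
      hr₁.combo hr₂ hp hq hpq, ?_, ?_⟩
    · convert hs₁.combo hs₂ hp hq hpq using 1
      simp only [Prod.smul_mk, Prod.mk_add_mk, smul_add]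
      abel
    · have h3 := mul_le_mul_of_nonneg_left h₁ hp
      have h4 := mul_le_mul_of_nonneg_left h₂ hq
      have h5 : z' z = p * z' z + q * z' z := by rw [← add_mul, hpq, one_mul]
      simp only [Prod.smul_mk, Prod.mk_add_mk, smul_eq_mul, add_apply, smul_apply, map_sub,
        map_add, map_smul] at h3 h4 ⊢
      linarith
  obtain ⟨p, hp⟩ := exists_dual_le_of_convex hE (ε := δ)
    (M := M * (‖x₀ - z‖ + δ) + (a₀ x₀ - a₀ z - z' (x₀ - z)))
    (fun v r r' ⟨x, a, b, s, u, h1, h2, h3⟩ hr => ⟨x, a, b, s, u, h1, h2, h3.trans hr⟩) hδ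
    (fun v hv => by
      have hx : x₀ + v ∈ Metric.ball x₀ δ := by simpa [mem_ball_iff_norm] using hv
      obtain ⟨b, hb⟩ := interior_subset (hsub hx)
      refine ⟨x₀, a₀, b, a₀ x₀, b (x₀ + v), EpiFitz.of_mem hA.1 ha₀, EpiFitz.of_mem hB.1 hb, ?_⟩
      have h1 : b (x₀ + v - z) ≤ M * (‖x₀ - z‖ + δ) := by
        refine (le_abs_self _).trans ((b.le_opNorm _).trans ?_)
        gcongr
        · exact hbd _ hx b hb
        · calc ‖x₀ + v - z‖ = ‖x₀ - z + v‖ := by congr 1; abel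
            _ ≤ ‖x₀ - z‖ + ‖v‖ := norm_add_le _ _
            _ ≤ ‖x₀ - z‖ + δ := by gcongr
      simp only [map_sub, add_apply] at h1 ⊢
      linarith)
    (fun l ⟨x, a, b, r, s, hr, hs, hl⟩ =>
      (hfitz x a b r s hr (by simpa using hs)).trans hl)
  have hsplit : ∀ x (a : Dual' X), a ∈ A x → ∀ y (b : Dual' X), b ∈ B y →
      0 ≤ (z' - p - a) (z - x) + (p - b) (z - y) := by
    intro x a ha y b hb
    have h1 := hp (y - x) _ ⟨x, a, b, a x, b y, EpiFitz.of_mem hA.1 ha,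
      by simpa using EpiFitz.of_mem hB.1 hb, le_rfl⟩
    simp only [sub_apply, add_apply, map_sub] at h1 ⊢
    linarith
  have hpA : z' - p ∈ A z := by
    refine hA.2 z _ fun x a ha => ?_
    by_contra! hneg
    have hpB : p ∈ B z := hB.2 z p fun y b hb => by linarith [hsplit x a ha y b hb]
    have := hsplit x a ha z p hpB
    simp only [sub_self, map_zero, add_zero] at this
    linarith
  have hpB : p ∈ B z := hB.2 z p fun y b hb => by
    have := hsplit z _ hpA y b hb
    simpa using this
  exact ⟨z' - p, hpA, p, hpB, sub_add_cancel _ _⟩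

/-- The case of a base point outside the closure of `dom B`. -/
theorem FPV.exists_sum_neg_of_notMem_closure [CompleteSpace X] {A B : X → Set (Dual' X)}
    (hA : FPV A) (hdom : Convex ℝ (domOp A)) (hB : MaxMonotone B)
    (hint : (domOp A ∩ interior (domOp B)).Nonempty)
    (hsub : domOp A ∩ closure (domOp B) ⊆ domOp B) {z : X} (hz : z ∉ closure (domOp B))
    (z' : Dual' X) : ∃ y, ∃ a ∈ A y, ∃ b ∈ B y, (z' - (a + b)) (z - y) < 0 := by
  obtain ⟨x₀, hx₀A, hx₀⟩ := hint
  obtain ⟨δ, hδ, hball⟩ := Metric.isOpen_iff.1 isOpen_interior x₀ hx₀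
  obtain ⟨ρ, hρ, hρz⟩ := Metric.isOpen_iff.1 isClosed_closure.isOpen_compl z hz
  have hfar : ∀ y ∈ closure (domOp B), ρ ≤ ‖z - y‖ := by
    intro y hy
    by_contra! hlt
    exact hρz (show y ∈ Metric.ball z ρ by rwa [mem_ball_iff_norm']) hy
  obtain ⟨η, hη, w, hw⟩ := exists_thickening_segment x₀ z hδ hρ
  set U := Metric.thickening η (segment ℝ x₀ z) with hUdef
  have hUo : IsOpen U := Metric.isOpen_thickening
  have hUc : Convex ℝ U := (convex_segment x₀ z).thickening η
  have hx₀U : x₀ ∈ U := Metric.self_subset_thickening hη _ (left_mem_segment ℝ x₀ z)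
  have hzU : z ∈ U := Metric.self_subset_thickening hη _ (right_mem_segment ℝ x₀ z)
  have hcl := hB.closure_interior_domOp ⟨x₀, hx₀⟩
  by_contra! hcon
  have hfront : ∀ y ∈ U, y ∈ domOp A → y ∈ closure (domOp B) → y ∈ interior (domOp B) := by
    intro y hyU hyA hyB
    by_contra hyint
    obtain ⟨n, hn⟩ := geometric_hahn_banach_open_point hB.convex_interior_domOp isOpen_interior
      hyint
    have hncl : closure (domOp B) ⊆ {x | n x ≤ n y} := by
      rw [← hcl]
      exact closure_minimal (fun x hx => (hn x hx).le) (isClosed_le n.continuous continuous_const)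
    have hpos : 0 < n (z - y) := by
      rcases (hw y hyU (hfar y hyB)).2 with hy | ⟨κ, hκ, x, hx, hzy⟩
      · exact absurd (hball hy) hyint
      · rw [hzy, map_smul, map_sub]
        exact mul_pos hκ (sub_pos.2 (hn x (hball hx)))
    obtain ⟨b, hb⟩ := hsub ⟨hyA, hyB⟩
    obtain ⟨a, ha⟩ := hyA
    set Q := (z' - (a + b)) (z - y) with hQ
    have h1 := hcon y a ha _ (hB.add_smul_mem hb (fun x hx => hncl (subset_closure hx))
      (show 0 ≤ (|Q| + 1) / n (z - y) by positivity))
    have h2 : (z' - (a + (b + ((|Q| + 1) / n (z - y)) • n))) (z - y) = Q - (|Q| + 1) := by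
      rw [hQ]
      simp only [sub_apply, add_apply, smul_apply, smul_eq_mul]
      rw [div_mul_cancel₀ _ hpos.ne']
      ring
    rw [h2] at h1
    linarith [le_abs_self Q]
  have hUB : ∀ y ∈ U, y ∈ domOp A → y ∈ interior (domOp B) := by
    intro y hyU hyA
    have hpre : IsPreconnected (U ∩ domOp A) := (hUc.inter hdom).isPreconnected
    by_contra hyint
    obtain ⟨x, ⟨hxU, hxA⟩, hx1, hx2⟩ := hpre (interior (domOp B)) (closure (domOp B))ᶜ
      isOpen_interior isClosed_closure.isOpen_compl
      (fun x hx => by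
        by_cases hxB : x ∈ closure (domOp B)
        · exact Or.inl (hfront x hx.1 hx.2 hxB)
        · exact Or.inr hxB)
      ⟨x₀, ⟨hx₀U, hx₀A⟩, hx₀⟩
      ⟨y, ⟨hyU, hyA⟩, fun hyB => hyint (hfront y hyU hyA hyB)⟩
    exact hx2 (subset_closure (interior_subset hx1))
  obtain ⟨y, a, ha, b, hb, hlt⟩ := hA.exists_sum_neg_of_far hB.1 hx₀A hx₀ hUo hUc hx₀U hzU hρ
    (fun y hyU hyA => ⟨interior_subset (hUB y hyU hyA),
      hfar y (subset_closure (interior_subset (hUB y hyU hyA)))⟩) z'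
  exact absurd (hcon y a ha b hb) (not_le.2 hlt)

/-- The case of a base point in the interior of `dom B`. -/
theorem FPV.exists_sum_lt_of_mem_interior [CompleteSpace X] {A B : X → Set (Dual' X)}
    (hA : FPV A) (hB : MaxMonotone B) (hint : (domOp A ∩ interior (domOp B)).Nonempty) {z : X}
    (hz : z ∈ interior (domOp B)) (z' : Dual' X) {ε : ℝ} (hε : 0 < ε) :
    ∃ y, ∃ a ∈ A y, ∃ b ∈ B y, (z' - (a + b)) (z - y) < ε := by
  by_cases hzA : z ∈ domOp A
  · obtain ⟨a, ha⟩ := hzA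
    obtain ⟨b, hb⟩ := interior_subset hz
    exact ⟨z, a, ha, b, hb, by simpa using hε⟩
  by_cases hzcl : z ∈ closure (domOp A)
  · obtain ⟨δ, hδ, M, hM, hsub, hbd⟩ := hB.1.locallyBounded hz
    set η := min δ (ε / (M + 1)) with hη
    have hη0 : 0 < η := by positivity
    obtain ⟨y, hyη, a, ha, hneg⟩ := hA.exists_neg Metric.isOpen_ball (convex_ball z η)
      (mem_closure_iff.1 hzcl _ Metric.isOpen_ball (Metric.mem_ball_self hη0))
      (Metric.mem_ball_self hη0) hzA z'
    have hyδ : y ∈ Metric.ball z δ := Metric.ball_subset_ball (min_le_left _ _) hyη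
    obtain ⟨b, hb⟩ := interior_subset (hsub hyδ)
    refine ⟨y, a, ha, b, hb, ?_⟩
    have h1 : -b (z - y) ≤ M * ‖z - y‖ := by
      refine (neg_le_abs _).trans ((b.le_opNorm _).trans ?_)
      gcongr
      exact hbd y hyδ b hb
    have h2 : ‖z - y‖ * (M + 1) < ε := by
      rw [← lt_div_iff₀ (by positivity)]
      exact (mem_ball_iff_norm'.1 hyη).trans_le (min_le_right _ _)
    simp only [sub_apply, add_apply] at hneg ⊢
    linarith [norm_nonneg (z - y)]
  · obtain ⟨x₀, hx₀A, hx₀⟩ := hint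
    obtain ⟨ρ, hρ, hρz⟩ := Metric.isOpen_iff.1 isClosed_closure.isOpen_compl z hzcl
    obtain ⟨y, a, ha, b, hb, hlt⟩ := hA.exists_sum_neg_of_far hB.1 hx₀A hx₀ isOpen_interior
      hB.convex_interior_domOp hx₀ hz hρ (fun y hyU hyA => ⟨interior_subset hyU, by
        by_contra! hlt
        exact hρz (show y ∈ Metric.ball z ρ by rwa [mem_ball_iff_norm'])
          (subset_closure hyA)⟩) z'
    exact ⟨y, a, ha, b, hb, hlt.trans hε⟩

theorem FPV.exists_sum_lt [CompleteSpace X] {A B : X → Set (Dual' X)}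
    (hA : FPV A) (hdom : Convex ℝ (domOp A)) (hB : MaxMonotone B)
    (hint : (domOp A ∩ interior (domOp B)).Nonempty)
    (hsub : domOp A ∩ closure (domOp B) ⊆ domOp B) (z : X) (z' : Dual' X) {ε : ℝ} (hε : 0 < ε) :
    ∃ y, ∃ a ∈ A y, ∃ b ∈ B y, (z' - (a + b)) (z - y) < ε := by
  by_cases hz : z ∈ closure (domOp B)
  · by_contra! hcon
    obtain ⟨x₀, ⟨a₀, ha₀⟩, hx₀⟩ := id hint
    obtain ⟨b₀, hb₀⟩ := interior_subset hx₀
    set D := (z' - (a₀ + b₀)) (z - x₀) with hD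
    obtain ⟨s, hs0, hs1, hs⟩ : ∃ s : ℝ, 0 < s ∧ s < 1 ∧ s * D ≤ ε / 2 := by
      refine ⟨min (1 / 2) (ε / (2 * (|D| + 1))), by positivity,
        (min_le_left _ _).trans_lt (by norm_num), ?_⟩
      calc min (1 / 2) (ε / (2 * (|D| + 1))) * D ≤ ε / (2 * (|D| + 1)) * (|D| + 1) := by
            have hmin : 0 ≤ min (1 / 2) (ε / (2 * (|D| + 1))) := by positivity
            refine (mul_le_mul_of_nonneg_left (le_abs_self D) hmin).trans ?_
            gcongr
            · exact min_le_right _ _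
            · linarith
        _ = ε / 2 := by field_simp
    rw [← hB.closure_interior_domOp ⟨x₀, hx₀⟩] at hz
    have hzs : s • x₀ + (1 - s) • z ∈ interior (domOp B) := by
      rw [← isOpen_interior.interior_eq (s := interior (domOp B))] at hx₀ ⊢
      exact hB.convex_interior_domOp.combo_interior_closure_mem_interior hx₀ hz hs0
        (by linarith) (by ring)
    obtain ⟨y, a, ha, b, hb, hlt⟩ := hA.exists_sum_lt_of_mem_interior hB hint hzs
      (s • (a₀ + b₀) + (1 - s) • z') (show 0 < (1 - s) * (ε / 2) by
        have : 0 < 1 - s := by linarith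
        positivity)
    have h1 := hA.1.1 x₀ y a₀ a ha₀ ha
    have h2 := hB.1 x₀ y b₀ b hb₀ hb
    have h3 := mul_le_mul_of_nonneg_left (hcon y a ha b hb) (show 0 ≤ 1 - s by linarith)
    have h4 := mul_nonneg hs0.le (add_nonneg h1 h2)
    have h5 := mul_le_mul_of_nonneg_left hs (show 0 ≤ 1 - s by linarith)
    simp only [hD, sub_apply, add_apply, smul_apply, smul_eq_mul, map_sub, map_add,
      map_smul] at h3 h4 h5 hlt
    linarith
  · obtain ⟨y, a, ha, b, hb, hlt⟩ :=
      hA.exists_sum_neg_of_notMem_closure hdom hB hint hsub hz z'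
    exact ⟨y, a, ha, b, hb, hlt.trans hε⟩

end SumTheorem

variable [NormedAddCommGroup X] [NormedSpace ℝ X] [CompleteSpace X]

theorem stmt11 (A B : X → Set (Dual' X)) (hA : FPV A) (hdom : Convex ℝ (domOp A))
    (hB : MaxMonotone B) (hint : (domOp A ∩ interior (domOp B)).Nonempty)
    (hsub : domOp A ∩ closure (domOp B) ⊆ domOp B) :
    MaxMonotone (opSum A B) := by
  exact hA.1.opSum_of_forall_exists_lt hB hint fun z z' ε hε =>
    hA.exists_sum_lt hdom hB hint hsub z z' hε
end
end

section
/- Let X be a real Banach space, A : X ⇉ X* a maximal monotone linear relation, and B : X ⇉ X* maximal monotone with dom A ∩ int dom B ≠ ∅ and dom A ∩ cl(dom B) ⊆ dom B. Then A + B is maximal monotone. -/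
open Set Filter Pointwise

noncomputable section

variable {X : Type*}

section SumTheorem

open Metric

variable [NormedAddCommGroup X] [NormedSpace ℝ X]

/-- Sandwich theorem for two convex subsets of `X × ℝ`, seen as epigraphs. -/
theorem exists_dual_sandwich {E F : Set (X × ℝ)} (hE : Convex ℝ E) (hF : Convex ℝ F)
    (h : ∀ x s t, (x, s) ∈ E → (x, t) ∈ F → 0 ≤ s + t) {x₀ : X} {s₀ r M : ℝ} (hr : 0 < r)
    (h₀ : (x₀, s₀) ∈ E) (hball : ∀ y ∈ ball x₀ r, ∃ t ≤ M, (y, t) ∈ F) :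
    ∃ v : Dual' X, ∀ x s y t, (x, s) ∈ E → (y, t) ∈ F → v x - v y ≤ s + t := by
  set W : Set (X × ℝ) :=
    {w | ∃ x s y t, (x, s) ∈ E ∧ (y, t) ∈ F ∧ w.1 = x - y ∧ s + t < w.2} with hW
  have hWc : Convex ℝ W := by
    rintro ⟨w, τ⟩ ⟨x, s, y, t, hx, hy, hw, hτ⟩ ⟨w', τ'⟩ ⟨x', s', y', t', hx', hy', hw', hτ'⟩
      a b ha hb hab
    refine ⟨_, _, _, _, hE hx hx' ha hb hab, hF hy hy' ha hb hab, ?_, ?_⟩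
    · simp only at hw hw'
      simp only [Prod.fst_add, Prod.smul_fst, hw, hw']
      module
    · simp only [Prod.snd_add, Prod.smul_snd, smul_eq_mul] at hτ hτ' ⊢
      rcases ha.eq_or_lt with rfl | ha'
      · have : b = 1 := by linarith
        subst this; linarith
      · nlinarith [mul_lt_mul_of_pos_left hτ ha', mul_le_mul_of_nonneg_left hτ'.le hb]
  have hsub : ball (0 : X) r ×ˢ Ioi (s₀ + M) ⊆ W := by
    rintro ⟨w, τ⟩ ⟨hw, hτ⟩
    obtain ⟨t, ht, hyt⟩ := hball (x₀ - w) (by simpa using hw)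
    refine ⟨x₀, s₀, x₀ - w, t, h₀, hyt, by simp, ?_⟩
    simp only [mem_Ioi] at hτ
    simp only
    linarith
  have hO : ball (0 : X) r ×ˢ Ioi (s₀ + M) ⊆ interior W :=
    interior_maximal hsub (isOpen_ball.prod isOpen_Ioi)
  have hT : ((0 : X), |s₀ + M| + 1) ∈ interior W :=
    hO ⟨by simpa using hr, by simp only [mem_Ioi]; linarith [le_abs_self (s₀ + M)]⟩
  have h0 : (0 : X × ℝ) ∉ interior W := by
    intro h0
    obtain ⟨x, s, y, t, hx, hy, hxy, hst⟩ := interior_subset h0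
    have : x = y := by simpa [eq_comm, sub_eq_zero] using hxy
    subst this
    simp only [Prod.snd_zero] at hst
    linarith [h x s t hx hy]
  obtain ⟨f, hf⟩ := geometric_hahn_banach_open_point hWc.interior isOpen_interior h0
  rw [map_zero] at hf
  have hfW : ∀ w ∈ W, f w ≤ 0 := by
    intro w hw
    have : w ∈ closure (interior W) := by
      rw [hWc.closure_interior_eq_closure_of_nonempty_interior ⟨_, hT⟩]
      exact subset_closure hw
    exact closure_minimal (fun w hw => (hf w hw).le)
      (isClosed_le f.continuous continuous_const) this
  have hsplit : ∀ (x : X) (τ : ℝ), f (x, τ) = f (x, 0) + τ * f (0, 1) := by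
    intro x τ
    rw [← smul_eq_mul, ← map_smul, ← map_add]
    simp
  have hκ : f (0, 1) < 0 := by
    have h1 := hf _ hT
    have h00 : f ((0 : X), (0 : ℝ)) = 0 := map_zero f
    rw [hsplit, h00, zero_add] at h1
    by_contra! hc
    have := mul_nonneg (by positivity : (0 : ℝ) ≤ |s₀ + M| + 1) hc
    linarith
  refine ⟨(-(f (0, 1))⁻¹) • f.comp (ContinuousLinearMap.inl ℝ X ℝ), ?_⟩
  intro x s y t hx hy
  rw [← map_sub]
  refine le_of_forall_pos_le_add fun ε hε => ?_
  have h1 := hfW (x - y, s + t + ε) ⟨x, s, y, t, hx, hy, rfl, by simpa using hε⟩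
  rw [hsplit] at h1
  simp only [smul_apply, ContinuousLinearMap.comp_apply,
    ContinuousLinearMap.inl_apply, smul_eq_mul]
  rw [neg_mul, inv_mul_eq_div, ← div_neg, div_le_iff₀ (by linarith)]
  linarith

/-- The convex hull of the graph of `B`, lifted by the duality pairing. -/
def hullGraph (B : X → Set (Dual' X)) : Set (X × Dual' X × ℝ) :=
  convexHull ℝ {p | p.2.1 ∈ B p.1 ∧ p.2.2 = p.2.1 p.1}

theorem mem_hullGraph {B : X → Set (Dual' X)} {b : X} {b' : Dual' X} (h : b' ∈ B b) :
    (b, b', b' b) ∈ hullGraph B :=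
  subset_convexHull ℝ _ ⟨h, rfl⟩

theorem pairing_le_of_mem_hullGraph {B : X → Set (Dual' X)} (hB : MonotoneOp B)
    {p q : X × Dual' X × ℝ} (hp : p ∈ hullGraph B) (hq : q ∈ hullGraph B) :
    p.2.1 q.1 + q.2.1 p.1 ≤ p.2.2 + q.2.2 := by
  have key : ∀ q : X × Dual' X × ℝ,
      Convex ℝ {p : X × Dual' X × ℝ | p.2.1 q.1 + q.2.1 p.1 ≤ p.2.2 + q.2.2} := by
    intro q p hp p' hp' a b ha hb hab
    simp only [mem_ofPred_eq, Prod.fst_add, Prod.snd_add, Prod.smul_fst, Prod.smul_snd, map_add,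
      map_smul, add_apply, smul_apply, smul_eq_mul]
      at hp hp' ⊢
    have e : q.2.2 = a * q.2.2 + b * q.2.2 := by rw [← add_mul, hab, one_mul]
    rw [e]
    nlinarith [mul_le_mul_of_nonneg_left hp ha, mul_le_mul_of_nonneg_left hp' hb]
  refine convexHull_min ?_ (key q) hp
  rintro p ⟨hp, hps⟩
  have := convexHull_min (t := {q | q.2.1 p.1 + p.2.1 q.1 ≤ q.2.2 + p.2.2}) ?_ (key p) hq
  · simp only [mem_ofPred_eq] at this ⊢
    linarith
  rintro q ⟨hq, hqs⟩
  have := hB _ _ _ _ hp hq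
  simp only [sub_apply, map_sub] at this
  simp only [mem_ofPred_eq, hps, hqs]
  linarith

theorem fst_mem_convexHull_domOp {B : X → Set (Dual' X)} {p : X × Dual' X × ℝ}
    (hp : p ∈ hullGraph B) : p.1 ∈ convexHull ℝ (domOp B) :=
  convexHull_min (t := Prod.fst ⁻¹' convexHull ℝ (domOp B))
    (fun p hp => subset_convexHull ℝ _ ⟨p.2.1, hp.1⟩)
    ((convex_convexHull ℝ _).is_linear_preimage (LinearMap.fst ℝ X (Dual' X × ℝ)).isLinear) hp

theorem exists_mem_hullGraph {B : X → Set (Dual' X)} {w : X}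
    (hw : w ∈ convexHull ℝ (domOp B)) : ∃ p ∈ hullGraph B, p.1 = w :=
  convexHull_min (t := Prod.fst '' hullGraph B)
    (by rintro b ⟨b', hb⟩; exact ⟨_, mem_hullGraph hb, rfl⟩)
    ((convex_convexHull ℝ _).is_linear_image (LinearMap.fst ℝ X (Dual' X × ℝ)).isLinear) hw

theorem mul_norm_le_of_forall_le {f : Dual' X} {ε c : ℝ} (hε : 0 < ε)
    (h : ∀ v, ‖v‖ ≤ ε → f v ≤ c) : ε * ‖f‖ ≤ c := by
  have hc : 0 ≤ c := by simpa using h 0 (by simpa using hε.le)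
  have key : ∀ x, f x ≤ c / ε * ‖x‖ := by
    intro x
    rcases eq_or_ne x 0 with rfl | hx
    · simp
    have hx' : 0 < ‖x‖ := norm_pos_iff.mpr hx
    have := h ((ε / ‖x‖) • x) (by
      rw [norm_smul, Real.norm_of_nonneg (by positivity), div_mul_cancel₀ _ hx'.ne'])
    rw [map_smul, smul_eq_mul, div_mul_eq_mul_div, div_le_iff₀ hx'] at this
    rw [div_mul_eq_mul_div, le_div_iff₀ hε]
    linarith
  have := f.opNorm_le_bound (by positivity) fun x => (abs_le'.mpr
    ⟨key x, by simpa using key (-x)⟩ : ‖f x‖ ≤ _)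
  rw [le_div_iff₀ hε] at this
  linarith

theorem exists_coercive_bound [CompleteSpace X] {B : X → Set (Dual' X)} (hB : MonotoneOp B)
    {x : X}
    (hx : x ∈ interior (convexHull ℝ (domOp B))) :
    ∃ r > 0, ∃ K, 0 ≤ K ∧ ∀ p ∈ hullGraph B,
      r * ‖p.2.1‖ ≤ p.2.2 - p.2.1 x + K * (1 + ‖p.1‖) := by
  set O := interior (convexHull ℝ (domOp B)) with hO
  set E : ℕ → Set X := fun n =>
    {w | ∀ p ∈ hullGraph B, p.2.1 w - p.2.2 ≤ n * (1 + ‖p.1‖)} with hEdef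
  have hEcl : ∀ n, IsClosed (E n) := by
    intro n
    have : E n = ⋂ p ∈ hullGraph B, {w | p.2.1 w - p.2.2 ≤ n * (1 + ‖p.1‖)} := by
      ext; simp [hEdef]
    rw [this]
    exact isClosed_biInter fun p _ =>
      isClosed_le (p.2.1.continuous.sub continuous_const) continuous_const
  have hcov : ∀ w ∈ convexHull ℝ (domOp B), ∃ n, w ∈ E n := by
    intro w hw
    obtain ⟨q, hq, rfl⟩ := exists_mem_hullGraph hw
    obtain ⟨n, hn⟩ := exists_nat_ge (|q.2.2| + ‖q.2.1‖)
    refine ⟨n, fun p hp => ?_⟩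
    have h1 := pairing_le_of_mem_hullGraph hB hp hq
    have h2 := (abs_le.mp (q.2.1.le_opNorm p.1)).1
    have h3 := le_abs_self q.2.2
    nlinarith [norm_nonneg p.1, norm_nonneg q.2.1, abs_nonneg q.2.2]
  have hdense := dense_iUnion_interior_of_closed (f := fun n => E n ∪ Oᶜ)
    (fun n => (hEcl n).union isOpen_interior.isClosed_compl) (by
      refine eq_univ_of_forall fun w => mem_iUnion.mpr ?_
      by_cases hw : w ∈ O
      · obtain ⟨n, hn⟩ := hcov w (interior_subset hw)
        exact ⟨n, Or.inl hn⟩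
      · exact ⟨0, Or.inr hw⟩)
  obtain ⟨p₀, hp₀O, hp₀⟩ := hdense.inter_open_nonempty O isOpen_interior ⟨x, hx⟩
  obtain ⟨n, hn⟩ := mem_iUnion.mp hp₀
  obtain ⟨ε, hε, hball⟩ := nhds_basis_closedBall.mem_iff.mp
    ((isOpen_interior.inter isOpen_interior).mem_nhds ⟨hn, hp₀O⟩)
  have hballE : ∀ v : X, ‖v‖ ≤ ε → p₀ + v ∈ E n := by
    intro v hv
    have hm := hball (show p₀ + v ∈ closedBall p₀ ε by simpa using hv)
    exact (interior_subset hm.1).resolve_right (fun h => h hm.2)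
  obtain ⟨δ, hδ, hδm⟩ : ∃ δ > (0 : ℝ), x - δ • (p₀ - x) ∈ O := by
    have hc : Continuous fun δ : ℝ => x - δ • (p₀ - x) := by fun_prop
    have := (isOpen_interior.preimage hc).mem_nhds (x := 0) (by simpa using hx)
    obtain ⟨η, hη, h⟩ := Metric.mem_nhds_iff.mp this
    exact ⟨η / 2, by positivity, h (by simp [abs_of_pos hη]; linarith)⟩
  obtain ⟨m, hm⟩ := hcov _ (interior_subset hδm)
  refine ⟨δ * ε / (δ + 1), by positivity, (δ * n + m) / (δ + 1), by positivity, fun p hp => ?_⟩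
  have key : ε * ‖p.2.1‖ ≤
      ((δ + 1) * (p.2.2 - p.2.1 x) + (δ * n + m) * (1 + ‖p.1‖)) / δ := by
    refine mul_norm_le_of_forall_le hε fun v hv => ?_
    have h1 := hballE v hv p hp
    have h2 := hm p hp
    simp only [map_add, map_sub, map_smul, smul_eq_mul] at h1 h2
    rw [le_div_iff₀ hδ]
    nlinarith [mul_le_mul_of_nonneg_left h1 hδ.le]
  rw [le_div_iff₀ hδ] at key
  have hδ1 : 0 < δ + 1 := by positivity
  rw [div_mul_eq_mul_div, div_le_iff₀ hδ1]
  have : (p.2.2 - p.2.1 x + (δ * n + m) / (δ + 1) * (1 + ‖p.1‖)) * (δ + 1) =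
      (δ + 1) * (p.2.2 - p.2.1 x) + (δ * n + m) * (1 + ‖p.1‖) := by
    field_simp
  rw [this]
  linarith

theorem interior_convexHull_domOp_subset [CompleteSpace X] {B : X → Set (Dual' X)}
    (hB : MaxMonotone B) : interior (convexHull ℝ (domOp B)) ⊆ domOp B := by
  intro x hx
  obtain ⟨r, hr, K, hK, hbd⟩ := exists_coercive_bound hB.1 hx
  obtain ⟨q, hq, -⟩ := exists_mem_hullGraph (interior_subset hx)
  set N := K * (2 + ‖x‖) with hN
  have hN0 : 0 ≤ N := by positivity
  set L := N / r + N with hL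
  have hlow : ∀ p ∈ hullGraph B, -(L * ‖p.1 - x‖) ≤ p.2.2 - p.2.1 x := by
    intro p hp
    by_contra! hlt
    have hL0 : 0 ≤ L := by positivity
    have hneg : p.2.2 - p.2.1 x < 0 := hlt.trans_le (by simp; positivity)
    have h1 := hbd p hp
    have h2 := pairing_le_of_mem_hullGraph hB.1 hp hp
    have h3 : ‖p.1‖ ≤ ‖p.1 - x‖ + ‖x‖ := by simpa using norm_add_le (p.1 - x) x
    have h4 := (abs_le.mp (p.2.1.le_opNorm (p.1 - x))).1
    rw [map_sub] at h4
    have hNr : 0 ≤ N / r := by positivity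
    rcases le_total ‖p.1 - x‖ 1 with h | h
    · have h5 : ‖p.2.1‖ ≤ N / r := by
        rw [le_div_iff₀ hr]
        nlinarith
      nlinarith [norm_nonneg (p.1 - x), mul_le_mul_of_nonneg_right h5 (norm_nonneg (p.1 - x))]
    · have h6 : 0 ≤ r * ‖p.2.1‖ := by positivity
      have h7 : 1 + ‖p.1‖ ≤ (2 + ‖x‖) * ‖p.1 - x‖ := by nlinarith [norm_nonneg x]
      have h8 : K * (1 + ‖p.1‖) ≤ N * ‖p.1 - x‖ := by
        rw [hN, mul_assoc]; exact mul_le_mul_of_nonneg_left h7 hK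
      nlinarith [norm_nonneg (p.1 - x)]
  have hL0 : 0 ≤ L := by positivity
  have hE : Convex ℝ {w : X × ℝ | ∃ p ∈ hullGraph B, w = (p.1 - x, p.2.2 - p.2.1 x)} := by
    rintro _ ⟨p, hp, rfl⟩ _ ⟨p', hp', rfl⟩ a b ha hb hab
    refine ⟨_, convex_convexHull ℝ _ hp hp' ha hb hab, Prod.ext ?_ ?_⟩
    · have : x = a • x + b • x := by rw [← add_smul, hab, one_smul]
      simp only [Prod.fst_add, Prod.smul_fst]
      nth_rw 3 [this]
      module
    · simp only [Prod.fst_add, Prod.snd_add, Prod.smul_fst, Prod.smul_snd,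
        add_apply, smul_apply, smul_eq_mul]
      ring
  have hF : Convex ℝ {w : X × ℝ | L * ‖w.1‖ ≤ w.2} := by
    simpa using ((convexOn_univ_norm (E := X)).smul hL0).convex_epigraph
  obtain ⟨v, hv⟩ := exists_dual_sandwich hE hF
    (by
      rintro y s t ⟨p, hp, he⟩ ht
      obtain ⟨rfl, rfl⟩ := Prod.mk.inj he
      have := hlow p hp
      simp only [mem_ofPred_eq] at ht
      linarith)
    one_pos ⟨q, hq, rfl⟩ (M := L * (‖q.1 - x‖ + 1)) (by
      intro y hy
      refine ⟨L * ‖y‖, mul_le_mul_of_nonneg_left ?_ hL0, by simp⟩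
      have := norm_add_le (y - (q.1 - x)) (q.1 - x)
      rw [sub_add_cancel] at this
      rw [mem_ball_iff_norm] at hy
      linarith)
  refine ⟨v, hB.2 x v fun y y' hy => ?_⟩
  have := hv _ _ 0 0 ⟨_, mem_hullGraph hy, rfl⟩ (by simp)
  simp only [map_sub, map_zero, sub_apply] at this ⊢
  linarith

theorem exists_bounded_on_ball [CompleteSpace X] {B : X → Set (Dual' X)} (hB : MonotoneOp B)
    {x : X} (hx : x ∈ interior (domOp B)) :
    ∃ r > 0, ∃ M, 0 ≤ M ∧ ball x r ⊆ domOp B ∧ ∀ y ∈ ball x r, ∀ y' ∈ B y, ‖y'‖ ≤ M := by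
  obtain ⟨r, hr, K, hK, hbd⟩ :=
    exists_coercive_bound hB (interior_mono (subset_convexHull ℝ (domOp B)) hx)
  obtain ⟨ε, hε, hεB⟩ := Metric.mem_nhds_iff.mp (mem_interior_iff_mem_nhds.mp hx)
  refine ⟨min ε (r / 2), by positivity, 2 * K * (1 + (‖x‖ + r / 2)) / r, by positivity,
    (ball_subset_ball (min_le_left _ _)).trans hεB, fun y hy y' hy' => ?_⟩
  rw [mem_ball_iff_norm, lt_min_iff] at hy
  have h1 := hbd _ (mem_hullGraph hy')
  have h2 := (abs_le.mp (y'.le_opNorm (y - x))).2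
  have h3 : ‖y‖ ≤ ‖y - x‖ + ‖x‖ := by simpa using norm_add_le (y - x) x
  simp only [map_sub] at h1 h2
  rw [le_div_iff₀ hr]
  have h4 : ‖y'‖ * ‖y - x‖ ≤ ‖y'‖ * (r / 2) := mul_le_mul_of_nonneg_left hy.2.le (norm_nonneg _)
  have h5 : K * (1 + ‖y‖) ≤ K * (1 + (‖x‖ + r / 2)) :=
    mul_le_mul_of_nonneg_left (by linarith [hy.2]) hK
  linarith

theorem closure_domOp_eq [CompleteSpace X] {B : X → Set (Dual' X)} (hB : MaxMonotone B)
    (h : (interior (domOp B)).Nonempty) :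
    closure (domOp B) = closure (convexHull ℝ (domOp B)) := by
  refine (closure_mono (subset_convexHull ℝ _)).antisymm ?_
  rw [← (convex_convexHull ℝ (domOp B)).closure_interior_eq_closure_of_nonempty_interior
    (h.mono (interior_mono (subset_convexHull ℝ _)))]
  exact closure_mono (interior_convexHull_domOp_subset hB)

theorem convex_closure_domOp [CompleteSpace X] {B : X → Set (Dual' X)} (hB : MaxMonotone B)
    (h : (interior (domOp B)).Nonempty) : Convex ℝ (closure (domOp B)) :=
  closure_domOp_eq hB h ▸ (convex_convexHull ℝ _).closure

/-- The graph of `A` is convex. -/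
def ConvexGraph (A : X → Set (Dual' X)) : Prop :=
  ∀ x y (x' y' : Dual' X) (a b : ℝ), x' ∈ A x → y' ∈ A y → 0 ≤ a → 0 ≤ b → a + b = 1 →
    a • x' + b • y' ∈ A (a • x + b • y)

theorem ConvexGraph.convex_domOp {A : X → Set (Dual' X)} (hA : ConvexGraph A) :
    Convex ℝ (domOp A) := by
  rintro x ⟨x', hx⟩ y ⟨y', hy⟩ a b ha hb hab
  exact ⟨_, hA _ _ _ _ _ _ hx hy ha hb hab⟩

/-- For a monotone operator with convex graph, the duality pairing is convex on the graph. -/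
theorem ConvexGraph.convex_epigraph {A : X → Set (Dual' X)} (hA : ConvexGraph A)
    (hm : MonotoneOp A) : Convex ℝ {w : X × ℝ | ∃ a' ∈ A w.1, a' w.1 ≤ w.2} := by
  rintro ⟨x, s⟩ ⟨x', hx, hxs⟩ ⟨y, t⟩ ⟨y', hy, hyt⟩ a b ha hb hab
  refine ⟨_, hA _ _ _ _ _ _ hx hy ha hb hab, ?_⟩
  have h := hm _ _ _ _ hx hy
  have hb' : b = 1 - a := by linarith
  simp only [Prod.fst_add, Prod.snd_add, Prod.smul_fst, Prod.smul_snd, map_add, map_sub, map_smul,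
    add_apply, sub_apply, smul_apply, smul_eq_mul] at h hxs hyt ⊢
  have h1 := mul_nonneg (mul_nonneg ha hb) h
  subst hb'
  linear_combination a * hxs + (1 - a) * hyt + h1

theorem le_of_forall_Ioo {f : ℝ → ℝ} (hf : Continuous f) {c : ℝ}
    (h : ∀ t, 0 < t → t < 1 → f t ≤ c) : f 0 ≤ c := by
  have h0 : (0 : ℝ) ∈ closure (Ioo 0 1) := by
    rw [closure_Ioo zero_ne_one]; exact ⟨le_rfl, zero_le_one⟩
  exact closure_minimal (fun t ht => h t ht.1 ht.2) (isClosed_le hf continuous_const) h0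

section Core

variable {A B : X → Set (Dual' X)}

theorem zero_mem_closure_domOp [CompleteSpace X] (hAc : ConvexGraph A) (hB : MaxMonotone B)
    (hcl : (0 : X) ∈ closure (domOp A)) (hint : (domOp A ∩ interior (domOp B)).Nonempty)
    (hsub : domOp A ∩ closure (domOp B) ⊆ domOp B)
    (hrel : ∀ x, ∀ a' ∈ A x, ∀ b' ∈ B x, 0 ≤ (a' + b') x) :
    (0 : X) ∈ closure (domOp B) := by
  by_contra h0
  obtain ⟨x₀, hx₀A, hx₀B⟩ := hint
  set C := closure (domOp B) with hC
  have hCc : Convex ℝ C := convex_closure_domOp hB ⟨_, hx₀B⟩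
  have hCi : interior (domOp B) ⊆ interior C := interior_mono subset_closure
  obtain ⟨d, hd, hdC⟩ := Metric.isOpen_iff.mp isClosed_closure.isOpen_compl (0 : X) h0
  have hdC' : ∀ y ∈ C, d ≤ ‖y‖ := by
    intro y hy
    by_contra! hlt
    exact hdC (by simpa using hlt) hy
  obtain ⟨r, hr, hrB⟩ := nhds_basis_closedBall.mem_iff.mp (isOpen_interior.mem_nhds hx₀B)
  obtain ⟨a, haA, haε⟩ := Metric.mem_closure_iff.mp hcl
    (min (d / 2) (d * r / (4 * (‖x₀‖ + d)))) (by positivity)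
  rw [dist_zero_left, lt_min_iff, lt_div_iff₀ two_pos, lt_div_iff₀ (by positivity)] at haε
  have hcont : Continuous fun s : ℝ => x₀ + s • (a - x₀) := by fun_prop
  obtain ⟨s, ⟨⟨hs0, hs1⟩, hsC⟩, hsmax⟩ := (isCompact_Icc.inter_right
    (isClosed_closure.preimage hcont) : IsCompact (Icc (0 : ℝ) 1 ∩
      (fun s : ℝ => x₀ + s • (a - x₀)) ⁻¹' C)).exists_isGreatest
    ⟨0, ⟨le_rfl, zero_le_one⟩, by simpa using interior_subset (hCi hx₀B)⟩
  simp only [mem_preimage] at hsC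
  set y := x₀ + s • (a - x₀) with hy
  have hslt : s < 1 := by
    refine lt_of_le_of_ne hs1 fun h => ?_
    have : y = a := by rw [hy, h]; module
    have hd' := hdC' y hsC
    rw [this] at hd'
    linarith [norm_nonneg a]
  have hyint : y ∉ interior C := by
    intro hyi
    obtain ⟨η, hη, hηC⟩ := Metric.mem_nhds_iff.mp
      ((isOpen_interior.preimage hcont).mem_nhds (x := s) hyi)
    have hpos : 0 < min (η / 2) (1 - s) := lt_min (by positivity) (by linarith)
    have hmem : s + min (η / 2) (1 - s) ∈ ball s η := by
      rw [mem_ball_iff_norm, add_sub_cancel_left, Real.norm_of_nonneg hpos.le]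
      exact (min_le_left _ _).trans_lt (by linarith)
    have := hsmax ⟨⟨by linarith, by linarith [min_le_right (η / 2) (1 - s)]⟩,
      interior_subset (s := C) (hηC hmem)⟩
    linarith
  have hyA : y ∈ domOp A := by
    have := hAc.convex_domOp hx₀A haA (sub_nonneg.mpr hs1) hs0 (sub_add_cancel _ _)
    convert this using 1
    rw [hy]; module
  obtain ⟨α, hα⟩ := hyA
  obtain ⟨β, hβ⟩ := hsub ⟨⟨α, hα⟩, hsC⟩
  obtain ⟨n, hn⟩ := geometric_hahn_banach_open_point hCc.interior isOpen_interior hyint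
  have hnC : ∀ c ∈ C, n c ≤ n y := by
    intro c hc
    have : c ∈ closure (interior C) := by
      rw [hCc.closure_interior_eq_closure_of_nonempty_interior ⟨_, hCi hx₀B⟩]
      exact subset_closure hc
    exact closure_minimal (fun w hw => (hn w hw).le)
      (isClosed_le n.continuous continuous_const) this
  have hβn : ∀ k : ℝ, 0 ≤ k → β + k • n ∈ B y := by
    intro k hk
    refine hB.2 _ _ fun z z' hz => ?_
    have h1 := hB.1 _ _ _ _ hβ hz
    have h2 := mul_nonneg hk (sub_nonneg.mpr (hnC z (subset_closure ⟨z', hz⟩)))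
    simp only [map_sub, sub_apply, add_apply, smul_apply, smul_eq_mul] at h1 ⊢
    linarith
  have hny : 0 ≤ n y := by
    by_contra! hneg
    have h1 := hrel y α hα _
      (hβn ((|(α + β) y| + 1) / -n y) (div_nonneg (by positivity) (by linarith)))
    rw [← add_assoc, add_apply, smul_apply, smul_eq_mul, div_neg, neg_mul,
      div_mul_cancel₀ _ hneg.ne] at h1
    linarith [le_abs_self ((α + β) y)]
  have hN : r * ‖n‖ ≤ n y - n x₀ := by
    refine mul_norm_le_of_forall_le hr fun v hv => ?_
    have := hnC (x₀ + v) (interior_subset (hCi (hrB (by simpa using hv))))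
    rw [map_add] at this
    linarith
  have hN0 : 0 < ‖n‖ := by
    refine norm_pos_iff.mpr fun h => ?_
    have := hn _ (hCi hx₀B)
    simp [h] at this
  have hny' : n y = n x₀ + s * (n a - n x₀) := by
    rw [hy, map_add, map_smul, map_sub, smul_eq_mul]
  have hna : n a ≤ ‖n‖ * ‖a‖ := (le_abs_self _).trans (n.le_opNorm a)
  have h1 : (1 - s) * r ≤ ‖a‖ := by
    refine le_of_mul_le_mul_left ?_ hN0
    have e1 : (1 - s) * (r * ‖n‖) ≤ (1 - s) * (n y - n x₀) :=
      mul_le_mul_of_nonneg_left hN (by linarith)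
    have e2 : (1 - s) * (n y - n x₀) = s * (n a - n y) := by rw [hny']; ring
    have e3 : s * (n a - n y) ≤ s * (‖n‖ * ‖a‖) := mul_le_mul_of_nonneg_left (by linarith) hs0
    have e4 : s * (‖n‖ * ‖a‖) ≤ ‖n‖ * ‖a‖ := mul_le_of_le_one_left (by positivity) hs1
    linarith
  have h2 : d - ‖a‖ ≤ (1 - s) * (‖x₀‖ + ‖a‖) := by
    have e1 : y = a + (1 - s) • (x₀ - a) := by rw [hy]; module
    have e2 : ‖y‖ ≤ ‖a‖ + (1 - s) * ‖x₀ - a‖ := by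
      rw [e1]
      refine (norm_add_le _ _).trans ?_
      rw [norm_smul, Real.norm_of_nonneg (by linarith)]
    have e3 := mul_le_mul_of_nonneg_left (norm_sub_le x₀ a) (by linarith : 0 ≤ 1 - s)
    linarith [hdC' y hsC]
  have h3 : (1 - s) * r * (‖x₀‖ + ‖a‖) ≤ ‖a‖ * (‖x₀‖ + d) :=
    mul_le_mul h1 (by linarith) (by positivity) (by positivity)
  have h4 := mul_le_mul_of_nonneg_left h2 hr.le
  have h5 := mul_le_mul_of_nonneg_left haε.1.le hr.le
  linarith [haε.2, mul_pos hd hr]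

theorem zero_mem_domOp [CompleteSpace X] (hA : MaxMonotone A) (hAc : ConvexGraph A)
    (hB : MaxMonotone B) (hint : (domOp A ∩ interior (domOp B)).Nonempty)
    (hsub : domOp A ∩ closure (domOp B) ⊆ domOp B)
    (hrel : ∀ x, ∀ a' ∈ A x, ∀ b' ∈ B x, 0 ≤ (a' + b') x)
    (h0 : (0 : X) ∈ closure (domOp B)) : (0 : X) ∈ domOp A := by
  obtain ⟨x₀, ⟨a₀, ha₀⟩, hx₀B⟩ := hint
  have hCc := convex_closure_domOp hB ⟨_, hx₀B⟩
  obtain ⟨r, hr, M, hM, hrB, hbd⟩ := exists_bounded_on_ball hB.1 hx₀B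
  have hF : Convex ℝ {w : X × ℝ | (∃ t : ℝ, 0 < t ∧ t ≤ 1 ∧ ‖w.1 - t • x₀‖ < t * r) ∧
      M * ‖w.1‖ ≤ w.2} := by
    rintro ⟨y, s⟩ ⟨⟨t, ht0, ht1, ht⟩, hs⟩ ⟨y', s'⟩ ⟨⟨t', ht0', ht1', ht'⟩, hs'⟩ a b ha hb hab
    simp only at ht ht' hs hs'
    refine ⟨⟨a * t + b * t', ?_, ?_, ?_⟩, ?_⟩
    · exact (convex_Ioi (0 : ℝ)) ht0 ht0' ha hb hab
    · exact (convex_Iic (1 : ℝ)) ht1 ht1' ha hb hab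
    · simp only [Prod.fst_add, Prod.smul_fst]
      have e : a • y + b • y' - (a * t + b * t') • x₀ =
          a • (y - t • x₀) + b • (y' - t' • x₀) := by module
      have e1 := norm_add_le (a • (y - t • x₀)) (b • (y' - t' • x₀))
      rw [← e, norm_smul, norm_smul, Real.norm_of_nonneg ha, Real.norm_of_nonneg hb] at e1
      rcases ha.eq_or_lt with rfl | ha'
      · have : b = 1 := by linarith
        subst this; linarith
      · nlinarith [mul_lt_mul_of_pos_left ht ha', mul_le_mul_of_nonneg_left ht'.le hb]
    · simp only [Prod.fst_add, Prod.smul_fst, Prod.snd_add, Prod.smul_snd, smul_eq_mul]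
      have e1 := norm_add_le (a • y) (b • y')
      rw [norm_smul, norm_smul, Real.norm_of_nonneg ha, Real.norm_of_nonneg hb] at e1
      linarith [mul_le_mul_of_nonneg_left e1 hM, mul_le_mul_of_nonneg_left hs ha,
        mul_le_mul_of_nonneg_left hs' hb]
  obtain ⟨v, hv⟩ := exists_dual_sandwich (hAc.convex_epigraph hA.1) hF
    (by
      rintro x s τ ⟨x', hx', hs⟩ ⟨⟨t, ht0, ht1, ht⟩, hτ⟩
      simp only at hx' hs ht hτ
      set c := t⁻¹ • x with hc
      have hxc : x = t • c := by rw [hc, smul_inv_smul₀ ht0.ne']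
      have hcball : c ∈ ball x₀ r := by
        rw [hxc, ← smul_sub, norm_smul, Real.norm_of_nonneg ht0.le] at ht
        rw [mem_ball_iff_norm]
        exact lt_of_mul_lt_mul_left ht ht0.le
      have hxC : x ∈ closure (domOp B) := by
        have := hCc (subset_closure (hrB hcball)) h0 ht0.le (sub_nonneg.mpr ht1)
          (add_sub_cancel _ _)
        rwa [smul_zero, add_zero, ← hxc] at this
      obtain ⟨β, hβ⟩ := hsub ⟨⟨x', hx'⟩, hxC⟩
      have hβM : β x ≤ M * ‖x‖ := by
        rcases ht1.eq_or_lt with h1 | h1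
        · have : x = c := by rw [hxc, h1, one_smul]
          exact (le_abs_self _).trans (β.le_of_opNorm_le (hbd x (this ▸ hcball) β hβ) x)
        · obtain ⟨γ, hγ⟩ := hrB hcball
          have e1 := hB.1 _ _ _ _ hγ hβ
          have e2 : c - x = (1 - t) • c := by rw [hxc]; module
          rw [e2, map_smul, smul_eq_mul, sub_apply] at e1
          have e3 := nonneg_of_mul_nonneg_right e1 (by linarith)
          have e4 : γ c ≤ M * ‖c‖ := (le_abs_self _).trans (γ.le_of_opNorm_le (hbd c hcball γ hγ) c)
          rw [hxc, map_smul, smul_eq_mul, norm_smul, Real.norm_of_nonneg ht0.le]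
          nlinarith
      have := hrel x x' hx' β hβ
      rw [add_apply] at this
      linarith)
    hr (x₀ := x₀) (s₀ := a₀ x₀) ⟨a₀, ha₀, le_rfl⟩ (M := M * (‖x₀‖ + r)) (by
      intro y hy
      rw [mem_ball_iff_norm] at hy
      have := norm_add_le (y - x₀) x₀
      rw [sub_add_cancel] at this
      exact ⟨M * ‖y‖, mul_le_mul_of_nonneg_left (by linarith) hM,
        ⟨1, one_pos, le_rfl, by simpa using hy⟩, le_rfl⟩)
  refine ⟨v, hA.2 0 v fun x x' hx => ?_⟩
  have := le_of_forall_Ioo (f := fun t => v x - t * v x₀ - M * (t * ‖x₀‖)) (by fun_prop)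
    (c := x' x) fun t ht0 ht1 => by
      have := hv x (x' x) (t • x₀) (M * (t * ‖x₀‖)) ⟨x', hx, le_rfl⟩
        ⟨⟨t, ht0, ht1.le, by simpa using mul_pos ht0 hr⟩, by
          simp [norm_smul, abs_of_pos ht0]⟩
      rw [map_smul, smul_eq_mul] at this
      linarith
  simp only [zero_sub, map_neg, sub_apply] at this ⊢
  linarith

theorem exists_mem_and_neg_mem [CompleteSpace X] (hA : MaxMonotone A) (hAc : ConvexGraph A)
    (hB : MaxMonotone B) (hcl : (0 : X) ∈ closure (domOp A))
    (hint : (domOp A ∩ interior (domOp B)).Nonempty)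
    (hsub : domOp A ∩ closure (domOp B) ⊆ domOp B)
    (hrel : ∀ x, ∀ a' ∈ A x, ∀ b' ∈ B x, 0 ≤ (a' + b') x) :
    ∃ v ∈ A 0, -v ∈ B 0 := by
  have h0C := zero_mem_closure_domOp hAc hB hcl hint hsub hrel
  obtain ⟨α, hα⟩ := zero_mem_domOp hA hAc hB hint hsub hrel h0C
  obtain ⟨β, hβ⟩ := hsub ⟨⟨α, hα⟩, h0C⟩
  obtain ⟨x₀, ⟨a₀, ha₀⟩, hx₀B⟩ := hint
  have hCc := convex_closure_domOp hB ⟨_, hx₀B⟩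
  obtain ⟨r, hr, M, hM, hrB, hbd⟩ := exists_bounded_on_ball hB.1 hx₀B
  have hF : Convex ℝ {w : X × ℝ | ∃ p ∈ hullGraph B, w = (p.1, p.2.2)} := by
    rintro _ ⟨p, hp, rfl⟩ _ ⟨p', hp', rfl⟩ a b ha hb hab
    exact ⟨_, convex_convexHull ℝ _ hp hp' ha hb hab, rfl⟩
  obtain ⟨v, hv⟩ := exists_dual_sandwich (hAc.convex_epigraph hA.1) hF
    (by
      rintro x s τ ⟨x', hx', hs⟩ ⟨p, hp, he⟩
      obtain ⟨rfl, rfl⟩ := Prod.mk.inj he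
      simp only at hx' hs
      have hpC : p.1 ∈ closure (domOp B) := by
        rw [closure_domOp_eq hB ⟨_, hx₀B⟩]
        exact subset_closure (fst_mem_convexHull_domOp hp)
      have hlim := le_of_forall_Ioo (f := fun t => t * p.2.1 p.1 -
        (1 - t) * (t * x' p.1 + (1 - t) * α p.1)) (by fun_prop) (c := p.2.2) fun t ht0 ht1 => by
          have ht1' : 0 ≤ 1 - t := by linarith
          have hα' := hAc _ _ _ _ _ _ hx' hα ht0.le ht1' (add_sub_cancel _ _)
          have hxC := hCc hpC h0C ht0.le ht1' (add_sub_cancel _ _)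
          rw [smul_zero, add_zero] at hα' hxC
          obtain ⟨γ, hγ⟩ := hsub ⟨⟨_, hα'⟩, hxC⟩
          have e1 := hrel _ _ hα' γ hγ
          have e2 := pairing_le_of_mem_hullGraph hB.1 hp (mem_hullGraph hγ)
          simp only [map_smul, add_apply, smul_apply, smul_eq_mul] at e1 e2
          have e3 := nonneg_of_mul_nonneg_right e1 ht0
          nlinarith [mul_nonneg ht1' e3]
      have e4 := hA.1 _ _ _ _ hx' hα
      simp only [sub_zero, sub_apply] at e4
      linarith)
    hr (x₀ := x₀) (s₀ := a₀ x₀) ⟨a₀, ha₀, le_rfl⟩ (M := M * (‖x₀‖ + r)) (by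
      intro y hy
      obtain ⟨b', hb'⟩ := hrB hy
      have e1 : b' y ≤ M * ‖y‖ := (le_abs_self _).trans (b'.le_of_opNorm_le (hbd y hy b' hb') y)
      rw [mem_ball_iff_norm] at hy
      have e2 := norm_add_le (y - x₀) x₀
      rw [sub_add_cancel] at e2
      exact ⟨b' y, e1.trans (mul_le_mul_of_nonneg_left (by linarith) hM),
        _, mem_hullGraph hb', rfl⟩)
  refine ⟨v, hA.2 _ _ fun x x' hx => ?_, hB.2 _ _ fun x x' hx => ?_⟩
  · have := hv x (x' x) 0 0 ⟨x', hx, le_rfl⟩ ⟨_, mem_hullGraph hβ, by simp⟩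
    simp only [zero_sub, map_neg, sub_apply, map_zero] at this ⊢
    linarith
  · have := hv 0 0 x (x' x) ⟨α, hα, by simp⟩ ⟨_, mem_hullGraph hx, rfl⟩
    simp only [zero_sub, map_neg, sub_apply, map_zero, neg_apply] at this ⊢
    linarith

end Core

/-- The translate of `A` whose graph is `gra A - (z, c)`. -/
def shiftOp (A : X → Set (Dual' X)) (z : X) (c : Dual' X) : X → Set (Dual' X) :=
  fun x => {x' | x' + c ∈ A (x + z)}

theorem MaxMonotone.shiftOp {A : X → Set (Dual' X)} (hA : MaxMonotone A) (z : X) (c : Dual' X) :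
    MaxMonotone (shiftOp A z c) := by
  refine ⟨fun x y x' y' hx hy => ?_, fun x x' h => hA.2 _ _ fun y y' hy => ?_⟩
  · simpa using hA.1 _ _ _ _ hx hy
  · have := h (y - z) (y' - c) (by simpa [_root_.shiftOp] using hy)
    convert this using 2 <;> abel

theorem domOp_shiftOp (A : X → Set (Dual' X)) (z : X) (c : Dual' X) :
    domOp (shiftOp A z c) = Homeomorph.addRight z ⁻¹' domOp A := by
  ext x
  exact ⟨fun ⟨x', hx⟩ => ⟨_, hx⟩, fun ⟨x', hx⟩ => ⟨x' - c, by simpa [shiftOp] using hx⟩⟩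

theorem LinearRel.convexGraph_shiftOp {A : X → Set (Dual' X)} (hA : LinearRel A) (z : X)
    (c : Dual' X) : ConvexGraph (shiftOp A z c) := by
  intro x y x' y' a b hx hy ha hb hab
  have := hA.2.1 _ _ _ _ (hA.2.2 a _ _ hx) (hA.2.2 b _ _ hy)
  have ez : a • (x + z) + b • (y + z) = a • x + b • y + (a + b) • z := by module
  have ec : a • (x' + c) + b • (y' + c) = a • x' + b • y' + (a + b) • c := by module
  rwa [ez, ec, hab, one_smul, one_smul] at this

theorem LinearRel.mem_of_forall_eq_zero {A : X → Set (Dual' X)} (hlin : LinearRel A)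
    (hA : MaxMonotone A) {f : Dual' X} (hf : ∀ x ∈ domOp A, f x = 0) : f ∈ A 0 := by
  refine hA.2 _ _ fun y y' hy => ?_
  have h1 := hA.1 _ _ _ _ hy hlin.1
  have h2 := hf y ⟨y', hy⟩
  simp only [sub_zero, zero_sub, map_neg, sub_apply] at h1 ⊢
  linarith

theorem LinearRel.exists_separating {A : X → Set (Dual' X)} (hlin : LinearRel A) {z : X}
    (hz : z ∉ closure (domOp A)) :
    ∃ f : Dual' X, (∀ x ∈ domOp A, f x = 0) ∧ f z ≠ 0 := by
  have hconv : Convex ℝ (domOp A) := by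
    rintro x ⟨x', hx⟩ y ⟨y', hy⟩ a b - - -
    exact ⟨_, hlin.2.1 _ _ _ _ (hlin.2.2 a _ _ hx) (hlin.2.2 b _ _ hy)⟩
  obtain ⟨f, u, hfz, hfu⟩ := geometric_hahn_banach_point_closed hconv.closure isClosed_closure hz
  have hu : u < 0 := by simpa using hfu 0 (subset_closure ⟨0, hlin.1⟩)
  refine ⟨f, fun x ⟨x', hx⟩ => ?_, by linarith⟩
  by_contra hne
  have := hfu ((u / f x) • x) (subset_closure ⟨_, hlin.2.2 _ _ _ hx⟩)
  rw [map_smul, smul_eq_mul, div_mul_cancel₀ _ hne] at this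
  exact lt_irrefl _ this

theorem LinearRel.mem_closure_domOp {A B : X → Set (Dual' X)} (hlin : LinearRel A)
    (hA : MaxMonotone A) (hAB : (domOp A ∩ domOp B).Nonempty) {z : X} {z' : Dual' X}
    (hrel : ∀ y y', y' ∈ opSum A B y → 0 ≤ (z' - y') (z - y)) : z ∈ closure (domOp A) := by
  by_contra hz
  obtain ⟨f, hf, hfz⟩ := hlin.exists_separating hz
  obtain ⟨x, ⟨a', ha⟩, ⟨b', hb⟩⟩ := hAB
  have hmem : ∀ k : ℝ, a' + k • f ∈ A x := by
    intro k
    simpa using hlin.2.1 _ _ _ _ ha (hlin.2.2 k _ _ (hlin.mem_of_forall_eq_zero hA hf))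
  set c := (z' - (a' + b')) (z - x) with hc
  have h := hrel x _ (add_mem_add (hmem ((c + 1) / f z)) hb)
  have e : (z' - (a' + ((c + 1) / f z) • f + b')) (z - x) = c - (c + 1) / f z * (f z - f x) := by
    simp only [hc, map_sub, sub_apply, add_apply, smul_apply, smul_eq_mul]
    ring
  rw [e, hf x ⟨a', ha⟩, sub_zero, div_mul_cancel₀ _ hfz] at h
  linarith

end SumTheorem

variable [NormedAddCommGroup X] [NormedSpace ℝ X] [CompleteSpace X]

theorem stmt12 (A B : X → Set (Dual' X)) (hA : MaxMonotone A) (hlin : LinearRel A)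
    (hB : MaxMonotone B) (hint : (domOp A ∩ interior (domOp B)).Nonempty)
    (hsub : domOp A ∩ closure (domOp B) ⊆ domOp B) :
    MaxMonotone (opSum A B) := by
  constructor
  · rintro x y _ _ ⟨a, ha, b, hb, rfl⟩ ⟨c, hc, d, hd, rfl⟩
    have h1 := hA.1 _ _ _ _ ha hc
    have h2 := hB.1 _ _ _ _ hb hd
    simp only [sub_apply, add_apply] at h1 h2 ⊢
    linarith
  · intro z z' hrel
    have hz := hlin.mem_closure_domOp hA
      (hint.mono (inter_subset_inter_right _ interior_subset)) hrel
    have hz0 : (0 : X) ∈ closure (domOp (shiftOp A z z')) := by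
      rw [domOp_shiftOp, ← Homeomorph.preimage_closure]
      simpa using hz
    have hint0 : (domOp (shiftOp A z z') ∩ interior (domOp (shiftOp B z 0))).Nonempty := by
      obtain ⟨x, hx⟩ := hint
      refine ⟨x - z, ?_⟩
      rw [domOp_shiftOp, domOp_shiftOp, ← Homeomorph.preimage_interior]
      simpa using hx
    have hsub0 : domOp (shiftOp A z z') ∩ closure (domOp (shiftOp B z 0)) ⊆
        domOp (shiftOp B z 0) := by
      rw [domOp_shiftOp, domOp_shiftOp, ← Homeomorph.preimage_closure]
      exact fun x hx => hsub hx
    obtain ⟨v, hvA, hvB⟩ := exists_mem_and_neg_mem (hA.shiftOp z z')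
      (hlin.convexGraph_shiftOp z z') (hB.shiftOp z 0) hz0 hint0 hsub0 fun x a' ha b' hb => by
        have := hrel _ _ (add_mem_add ha hb)
        simp only [sub_apply, add_apply, map_sub, map_add, zero_apply] at this ⊢
        linarith
    exact ⟨v + z', by simpa [shiftOp] using hvA, -v, by simpa [shiftOp] using hvB,
      add_neg_cancel_comm v z'⟩
end
end
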